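/- Let d ≥ 1, n₁,…,n_d ≥ 1, n = n₁+…+n_d. Suppose φ ∈ C¹(ℝⁿ) satisfies ‖φ‖_∞ ≤ 1 and, for each i = 1,…,d and every x ∈ ℝⁿ, the ℓ¹-norm of the gradient of φ in the i-th block of variables satisfies ‖∇_{x_i}φ(x)‖_{ℓ¹} ≤ 1. Let b be a measurable function with ‖b‖_∞ ≤ 1. Then for every α with 0 < α < 1 and every open set Ω ⊂ ℝⁿ of finite Lebesgue measure, Σ_{R dyadic rectangle, R ⊂ Ω, |R| ≤ α} ‖Δ_R(φ b)‖_{L²}² ≤ 2·d!·(‖b‖_{bmo,2}² + α^{2/n})·|Ω|. -/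

import Mathlib

open MeasureTheory ENNReal Filter

noncomputable section

/-- A dyadic cube in `ℝ^m`, recorded by its generation `k` and its corner index `j`;
it represents the set `∏ i, [j i * 2^k, (j i + 1) * 2^k)`. -/
structure DyadicCube (m : ℕ) where
  k : ℤ
  j : Fin m → ℤ

/-- The underlying set of a dyadic cube. -/
def dyadicCubeSet {m : ℕ} (c : DyadicCube m) : Set (Fin m → ℝ) :=
  {x | ∀ i, (c.j i : ℝ) * 2 ^ c.k ≤ x i ∧ x i < ((c.j i : ℝ) + 1) * 2 ^ c.k}

/-- The generation-`k` dyadic cube containing the point `x`. -/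
def dyadicCubeOf {m : ℕ} (k : ℤ) (x : Fin m → ℝ) : DyadicCube m :=
  ⟨k, fun i => ⌊x i / 2 ^ k⌋⟩

/-- `E_k f x`: the average of `f` over the generation-`k` dyadic cube containing `x`. -/
def Ek {m : ℕ} (k : ℤ) (f : (Fin m → ℝ) → ℝ) (x : Fin m → ℝ) : ℝ :=
  ⨍ y in dyadicCubeSet (dyadicCubeOf k x), f y

/-- The martingale difference operator `Δ_Q f = (E_{k-1} f - E_k f) · 1_Q`
for a dyadic cube `Q` of generation `k`. -/
def deltaQ {m : ℕ} (c : DyadicCube m) (f : (Fin m → ℝ) → ℝ) : (Fin m → ℝ) → ℝ :=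
  (dyadicCubeSet c).indicator (fun y => Ek (c.k - 1) f y - Ek c.k f y)

/-- The product space `ℝ^{n 0} × ⋯ × ℝ^{n (d-1)}`. -/
abbrev ProductSpace {d : ℕ} (n : Fin d → ℕ) : Type := ∀ i, (Fin (n i) → ℝ)

/-- A dyadic rectangle `R = Q₁ × ⋯ × Q_d`, one dyadic cube in each block. -/
abbrev DyadicRect {d : ℕ} (n : Fin d → ℕ) : Type := ∀ i, DyadicCube (n i)

/-- The underlying set of a dyadic rectangle. -/
def dyadicRectSet {d : ℕ} {n : Fin d → ℕ} (R : DyadicRect n) : Set (ProductSpace n) :=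
  {x | ∀ i, x i ∈ dyadicCubeSet (R i)}

/-- Apply the one-parameter operator `Δ_Q` in the `i`-th block of variables. -/
def deltaBlock {d : ℕ} {n : Fin d → ℕ} (i : Fin d) (c : DyadicCube (n i))
    (f : ProductSpace n → ℝ) (x : ProductSpace n) : ℝ :=
  deltaQ c (fun y => f (Function.update x i y)) (x i)

/-- The multiparameter difference operator `Δ_R = Δ_{Q₁} ⊗ ⋯ ⊗ Δ_{Q_d}`, obtained
by applying `Δ_{Q_i}` in the `i`-th block of variables. -/
def deltaR {d : ℕ} {n : Fin d → ℕ} (R : DyadicRect n) (f : ProductSpace n → ℝ) :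
    ProductSpace n → ℝ :=
  (List.finRange d).foldr (fun i g => deltaBlock i (R i) g) f

/-- The squared `L²` norm `‖g‖_{L²}²`, as an extended nonnegative real. -/
def l2normSq {d : ℕ} {n : Fin d → ℕ} (g : ProductSpace n → ℝ) : ℝ≥0∞ :=
  ∫⁻ x, ENNReal.ofReal (g x ^ 2)

/-- The multiparameter dyadic square function `S f (x) = (∑_R |Δ_R f(x)|²)^{1/2}`. -/
def squareFn {d : ℕ} {n : Fin d → ℕ} (f : ProductSpace n → ℝ) (x : ProductSpace n) : ℝ≥0∞ :=
  (∑' R : DyadicRect n, ENNReal.ofReal (deltaR R f x ^ 2)) ^ (1 / 2 : ℝ)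

/-- The dyadic product `H¹` norm `‖S f‖_{L¹}`. -/
def H1Norm {d : ℕ} {n : Fin d → ℕ} (f : ProductSpace n → ℝ) : ℝ≥0∞ :=
  ∫⁻ x, squareFn f x

/-- An axis-parallel cube in `ℝ^m` with arbitrary corner and (positive) side length. -/
structure Cube (m : ℕ) where
  corner : Fin m → ℝ
  side : ℝ
  side_pos : 0 < side

/-- The underlying set of a cube. -/
def cubeSet {m : ℕ} (c : Cube m) : Set (Fin m → ℝ) :=
  {x | ∀ i, c.corner i ≤ x i ∧ x i < c.corner i + c.side}

/-- A rectangle `R = Q₁ × ⋯ × Q_d`: an axis-parallel cube in each block. -/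
abbrev Rect {d : ℕ} (n : Fin d → ℕ) : Type := ∀ i, Cube (n i)

/-- The underlying set of a rectangle. -/
def rectSet {d : ℕ} {n : Fin d → ℕ} (R : Rect n) : Set (ProductSpace n) :=
  {x | ∀ i, x i ∈ cubeSet (R i)}

/-- The little `bmo` norm: `sup_R |R|⁻¹ ∫_R |f - f_R|` over all rectangles. -/
def bmo1 {d : ℕ} {n : Fin d → ℕ} (f : ProductSpace n → ℝ) : ℝ≥0∞ :=
  ⨆ R : Rect n,
    (volume (rectSet R))⁻¹ * ∫⁻ x in rectSet R, ENNReal.ofReal |f x - ⨍ y in rectSet R, f y|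

/-- The `L²`-based little `bmo` norm: `sup_R (|R|⁻¹ ∫_R |f - f_R|²)^{1/2}` over all
rectangles. -/
def bmo2 {d : ℕ} {n : Fin d → ℕ} (f : ProductSpace n → ℝ) : ℝ≥0∞ :=
  ⨆ R : Rect n,
    ((volume (rectSet R))⁻¹ *
      ∫⁻ x in rectSet R, ENNReal.ofReal ((f x - ⨍ y in rectSet R, f y) ^ 2)) ^ (1 / 2 : ℝ)

/-- The one-parameter `BMO` norm over all axis-parallel cubes in `ℝ^m`. -/
def bmo1Cube {m : ℕ} (g : (Fin m → ℝ) → ℝ) : ℝ≥0∞ :=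
  ⨆ Q : Cube m,
    (volume (cubeSet Q))⁻¹ * ∫⁻ x in cubeSet Q, ENNReal.ofReal |g x - ⨍ y in cubeSet Q, g y|

/-- The `L²`-based one-parameter `BMO` norm over all axis-parallel cubes in `ℝ^m`. -/
def bmo2Cube {m : ℕ} (g : (Fin m → ℝ) → ℝ) : ℝ≥0∞ :=
  ⨆ Q : Cube m,
    ((volume (cubeSet Q))⁻¹ *
      ∫⁻ x in cubeSet Q, ENNReal.ofReal ((g x - ⨍ y in cubeSet Q, g y) ^ 2)) ^ (1 / 2 : ℝ)

/-- The strong maximal function: supremum of averages of `|f|` over all rectangles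
containing the point. -/
def strongMaximal {d : ℕ} {n : Fin d → ℕ} (f : ProductSpace n → ℝ) (x : ProductSpace n) :
    ℝ≥0∞ :=
  ⨆ (R : Rect n) (_ : x ∈ rectSet R),
    (volume (rectSet R))⁻¹ * ∫⁻ y in rectSet R, ENNReal.ofReal |f y|

end

lemma mem_dyadicCubeSet_iff {m : ℕ} {c : DyadicCube m} {x : Fin m → ℝ} :
    x ∈ dyadicCubeSet c ↔ dyadicCubeOf c.k x = c := by
  obtain ⟨k, j⟩ := c
  have h2 : (0 : ℝ) < 2 ^ k := by positivity
  simp only [dyadicCubeSet, dyadicCubeOf, Set.mem_ofPred_eq, DyadicCube.mk.injEq, true_and,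
    funext_iff, Int.floor_eq_iff]
  refine forall_congr' fun i => ?_
  rw [le_div_iff₀ h2, div_lt_iff₀ h2]

lemma mem_dyadicCubeSet_dyadicCubeOf {m : ℕ} (k : ℤ) (x : Fin m → ℝ) :
    x ∈ dyadicCubeSet (dyadicCubeOf k x) :=
  mem_dyadicCubeSet_iff.2 rfl

lemma dyadicCubeSet_eq_pi {m : ℕ} (c : DyadicCube m) :
    dyadicCubeSet c =
      Set.univ.pi fun i => Set.Ico ((c.j i : ℝ) * 2 ^ c.k) (((c.j i : ℝ) + 1) * 2 ^ c.k) := by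
  ext x
  simp [dyadicCubeSet]

lemma measurableSet_dyadicCubeSet {m : ℕ} (c : DyadicCube m) :
    MeasurableSet (dyadicCubeSet c) := by
  rw [dyadicCubeSet_eq_pi]
  exact MeasurableSet.univ_pi fun i => measurableSet_Ico

lemma volume_dyadicCubeSet {m : ℕ} (c : DyadicCube m) :
    volume (dyadicCubeSet c) = ENNReal.ofReal (2 ^ c.k) ^ m := by
  rw [dyadicCubeSet_eq_pi, Real.volume_pi_Ico]
  have : ∀ i, ((c.j i : ℝ) + 1) * 2 ^ c.k - (c.j i : ℝ) * 2 ^ c.k = 2 ^ c.k := fun i => by ring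
  simp [this]

lemma volume_dyadicCubeSet_ne_top {m : ℕ} (c : DyadicCube m) :
    volume (dyadicCubeSet c) ≠ ∞ := by
  rw [volume_dyadicCubeSet]
  exact ENNReal.pow_ne_top ENNReal.ofReal_ne_top

lemma volume_dyadicCubeSet_ne_zero {m : ℕ} (c : DyadicCube m) :
    volume (dyadicCubeSet c) ≠ 0 := by
  rw [volume_dyadicCubeSet]
  have : (0 : ℝ) < 2 ^ c.k := by positivity
  exact pow_ne_zero _ (by simpa using this)

lemma floor_div_zpow_congr {a b : ℝ} {j k : ℤ} (hjk : j ≤ k)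
    (h : ⌊a / 2 ^ j⌋ = ⌊b / 2 ^ j⌋) : ⌊a / 2 ^ k⌋ = ⌊b / 2 ^ k⌋ := by
  obtain ⟨N, rfl⟩ := Int.le.dest hjk
  have key : ∀ a : ℝ, a / 2 ^ (j + (N : ℤ)) = a / 2 ^ j / ((2 ^ N : ℕ) : ℝ) := by
    intro a
    rw [zpow_add₀ (by norm_num), div_div]
    simp
  have h2 : ∀ a : ℝ, ⌊a / ((2 ^ N : ℕ) : ℝ)⌋ = ⌊a⌋ / ((2 ^ N : ℕ) : ℤ) := fun a =>
    Int.floor_div_natCast a _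
  rw [key, key, h2, h2, h]

lemma dyadicCubeOf_congr {m : ℕ} {x y : Fin m → ℝ} {j k : ℤ} (hjk : j ≤ k)
    (h : dyadicCubeOf j x = dyadicCubeOf j y) : dyadicCubeOf k x = dyadicCubeOf k y := by
  simp only [dyadicCubeOf, DyadicCube.mk.injEq, true_and, funext_iff] at h ⊢
  exact fun i => floor_div_zpow_congr hjk (h i)

/-- Two dyadic cubes are nested as soon as they meet. -/
lemma dyadicCubeSet_subset_or_disjoint {m : ℕ} {c M : DyadicCube m} (hk : c.k ≤ M.k) :
    dyadicCubeSet c ⊆ dyadicCubeSet M ∨ Disjoint (dyadicCubeSet c) (dyadicCubeSet M) := by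
  by_cases h : Disjoint (dyadicCubeSet c) (dyadicCubeSet M)
  · exact Or.inr h
  · obtain ⟨x, hxc, hxM⟩ := Set.not_disjoint_iff.1 h
    refine Or.inl fun y hy => ?_
    rw [mem_dyadicCubeSet_iff] at hxc hxM hy ⊢
    rw [← hxM]
    exact dyadicCubeOf_congr hk (hy.trans hxc.symm)

lemma dyadicCubeSet_disjoint_of_ne {m : ℕ} {c c' : DyadicCube m} (hk : c.k = c'.k)
    (hne : c ≠ c') : Disjoint (dyadicCubeSet c) (dyadicCubeSet c') := by
  refine Set.disjoint_left.2 fun x hx hx' => hne ?_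
  rw [mem_dyadicCubeSet_iff] at hx hx'
  rw [← hx, ← hx', hk]

instance countable_dyadicCube (m : ℕ) : Countable (DyadicCube m) := by
  refine Function.Injective.countable (f := fun c : DyadicCube m => (c.k, c.j)) ?_
  rintro ⟨k, j⟩ ⟨k', j'⟩ h
  simpa using h

lemma measurable_comp_dyadicCubeOf {m : ℕ} {β : Type*} [MeasurableSpace β] (k : ℤ)
    (W : DyadicCube m → β) : Measurable fun x => W (dyadicCubeOf k x) := by
  have h1 : Measurable fun x : Fin m → ℝ => fun i => ⌊x i / 2 ^ k⌋ :=
    measurable_pi_lambda _ fun i => ((measurable_pi_apply i).div_const _).floor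
  have h2 : Measurable fun p : Fin m → ℤ => W ⟨k, p⟩ := measurable_of_countable _
  exact h2.comp h1

/-- Bounded measurable real functions. -/
def BddMeas {X : Type*} [MeasurableSpace X] (f : X → ℝ) : Prop :=
  Measurable f ∧ ∃ C, ∀ x, |f x| ≤ C

namespace BddMeas
variable {X Y : Type*} [MeasurableSpace X] [MeasurableSpace Y] {f g : X → ℝ}

lemma const (a : ℝ) : BddMeas fun _ : X => a := ⟨measurable_const, |a|, fun _ => le_rfl⟩

lemma sub (hf : BddMeas f) (hg : BddMeas g) : BddMeas fun x => f x - g x := by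
  obtain ⟨hf, C, hC⟩ := hf
  obtain ⟨hg, D, hD⟩ := hg
  exact ⟨hf.sub hg, C + D, fun x => (abs_sub _ _).trans (add_le_add (hC x) (hD x))⟩

lemma mul (hf : BddMeas f) (hg : BddMeas g) : BddMeas fun x => f x * g x := by
  obtain ⟨hf, C, hC⟩ := hf
  obtain ⟨hg, D, hD⟩ := hg
  exact ⟨hf.mul hg, C * D, fun x => by
    rw [abs_mul]
    exact mul_le_mul (hC x) (hD x) (abs_nonneg _) ((abs_nonneg _).trans (hC x))⟩

lemma pow_two (hf : BddMeas f) : BddMeas fun x => f x ^ 2 := by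
  simpa only [sq] using hf.mul hf

lemma comp (hf : BddMeas f) {u : Y → X} (hu : Measurable u) : BddMeas fun y => f (u y) :=
  ⟨hf.1.comp hu, hf.2.imp fun _ hC y => hC (u y)⟩

lemma integrable (hf : BddMeas f) {μ : Measure X} [IsFiniteMeasure μ] : Integrable f μ := by
  obtain ⟨hf, C, hC⟩ := hf
  exact Integrable.of_bound hf.aestronglyMeasurable C (Eventually.of_forall hC)

lemma integrableOn (hf : BddMeas f) {μ : Measure X} {s : Set X} (hs : μ s ≠ ∞) :
    IntegrableOn f s μ := by
  have : IsFiniteMeasure (μ.restrict s) := ⟨by simpa using hs.lt_top⟩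
  exact hf.integrable

end BddMeas

lemma abs_setAverage_le {X : Type*} [MeasurableSpace X] {μ : Measure X} {s : Set X}
    {f : X → ℝ} {C : ℝ} (hC : ∀ x, |f x| ≤ C) (hs : μ s ≠ ∞) (hs0 : μ s ≠ 0) :
    |⨍ y in s, f y ∂μ| ≤ C := by
  have : IsFiniteMeasure (μ.restrict s) := ⟨by simpa using hs.lt_top⟩
  have : NeZero (μ.restrict s) := ⟨by simpa using hs0⟩
  rw [average, ← Real.norm_eq_abs]
  refine (norm_integral_le_of_norm_le_const (Eventually.of_forall hC)).trans ?_
  have h0 : (μ s).toReal ≠ 0 := ENNReal.toReal_ne_zero.2 ⟨hs0, hs⟩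
  simp [Measure.real, h0]

lemma BddMeas.Ek {m : ℕ} (k : ℤ) {g : (Fin m → ℝ) → ℝ} (hg : BddMeas g) :
    BddMeas (Ek k g) := by
  refine ⟨measurable_comp_dyadicCubeOf k fun c => ⨍ y in dyadicCubeSet c, g y, ?_⟩
  obtain ⟨-, C, hC⟩ := hg
  exact ⟨C, fun x => abs_setAverage_le hC (volume_dyadicCubeSet_ne_top _)
    (volume_dyadicCubeSet_ne_zero _)⟩

/-- Averaging over dyadic cubes of generation `j` preserves integrals against functions that are
constant on these cubes. -/
lemma setIntegral_mul_Ek {m : ℕ} {M : DyadicCube m} {j : ℤ} (hj : j ≤ M.k)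
    {g : (Fin m → ℝ) → ℝ} (hg : BddMeas g) (W : DyadicCube m → ℝ)
    (hW : BddMeas fun x => W (dyadicCubeOf j x)) :
    ∫ x in dyadicCubeSet M, W (dyadicCubeOf j x) * Ek j g x
      = ∫ x in dyadicCubeSet M, W (dyadicCubeOf j x) * g x := by
  set s : (Fin m → ℤ) → Set (Fin m → ℝ) := fun p => dyadicCubeSet M ∩ dyadicCubeSet ⟨j, p⟩
  have hs : ∀ p, MeasurableSet (s p) := fun p =>
    (measurableSet_dyadicCubeSet _).inter (measurableSet_dyadicCubeSet _)
  have hdisj : Pairwise (Function.onFun Disjoint s) := fun p q hpq =>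
    (dyadicCubeSet_disjoint_of_ne (c := ⟨j, p⟩) (c' := ⟨j, q⟩) rfl (by simpa using hpq)).mono
      Set.inter_subset_right Set.inter_subset_right
  have hU : ⋃ p, s p = dyadicCubeSet M := by
    refine Set.Subset.antisymm (Set.iUnion_subset fun p => Set.inter_subset_left) fun x hx => ?_
    exact Set.mem_iUnion.2 ⟨(dyadicCubeOf j x).j, hx, mem_dyadicCubeSet_dyadicCubeOf j x⟩
  have hsum : ∀ f : (Fin m → ℝ) → ℝ, BddMeas f →
      HasSum (fun p => ∫ x in s p, f x) (∫ x in dyadicCubeSet M, f x) := fun f hf => by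
    have := hasSum_integral_iUnion (μ := volume) hs hdisj
      (hf.integrableOn (by rw [hU]; exact volume_dyadicCubeSet_ne_top M))
    rwa [hU] at this
  have h1 := hsum _ (hW.mul (hg.Ek j))
  have h2 := hsum _ (hW.mul hg)
  refine h1.unique ?_
  convert h2 using 2 with p
  rcases dyadicCubeSet_subset_or_disjoint (c := ⟨j, p⟩) (M := M) hj with h | h
  · have hsp : s p = dyadicCubeSet ⟨j, p⟩ := Set.inter_eq_right.2 h
    rw [hsp]
    have hm := measurableSet_dyadicCubeSet (⟨j, p⟩ : DyadicCube m)
    have e1 : ∫ x in dyadicCubeSet ⟨j, p⟩, W (dyadicCubeOf j x) * Ek j g x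
        = ∫ x in dyadicCubeSet ⟨j, p⟩, W ⟨j, p⟩ * ⨍ y in dyadicCubeSet ⟨j, p⟩, g y := by
      refine setIntegral_congr_fun hm fun x hx => ?_
      have hx := mem_dyadicCubeSet_iff.1 hx
      simp only at hx
      simp only [Ek, hx]
    have e2 : ∫ x in dyadicCubeSet ⟨j, p⟩, W (dyadicCubeOf j x) * g x
        = ∫ x in dyadicCubeSet ⟨j, p⟩, W ⟨j, p⟩ * g x := by
      refine setIntegral_congr_fun hm fun x hx => ?_
      have hx := mem_dyadicCubeSet_iff.1 hx
      simp only at hx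
      simp only [hx]
    have hpos : (volume.real (dyadicCubeSet (⟨j, p⟩ : DyadicCube m))) ≠ 0 :=
      (ENNReal.toReal_ne_zero.2 ⟨volume_dyadicCubeSet_ne_zero _, volume_dyadicCubeSet_ne_top _⟩)
    rw [e1, e2, integral_const_mul (W ⟨j, p⟩) g, setIntegral_const, setAverage_eq, smul_eq_mul,
      smul_eq_mul]
    field_simp
  · have hsp : s p = ∅ := Set.disjoint_iff_inter_eq_empty.1 h.symm
    simp [hsp]

/-- The lower corner of a dyadic cube. -/
noncomputable def DyadicCube.corner {m : ℕ} (c : DyadicCube m) : Fin m → ℝ :=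
  fun i => (c.j i : ℝ) * 2 ^ c.k

lemma DyadicCube.corner_mem {m : ℕ} (c : DyadicCube m) : c.corner ∈ dyadicCubeSet c := by
  intro i
  have h2 : (0 : ℝ) < 2 ^ c.k := by positivity
  simp only [DyadicCube.corner]
  constructor <;> nlinarith

lemma setIntegral_mul_Ek' {m : ℕ} {M : DyadicCube m} {j : ℤ} (hj : j ≤ M.k)
    {g w : (Fin m → ℝ) → ℝ} (hg : BddMeas g) (hw : BddMeas w)
    (hwj : ∀ x y, dyadicCubeOf j x = dyadicCubeOf j y → w x = w y) :
    ∫ x in dyadicCubeSet M, w x * Ek j g x = ∫ x in dyadicCubeSet M, w x * g x := by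
  have h : ∀ x, w (dyadicCubeOf j x).corner = w x := fun x =>
    hwj _ _ (mem_dyadicCubeSet_iff.1 (dyadicCubeOf j x).corner_mem)
  simpa only [h] using setIntegral_mul_Ek hj hg (fun c => w c.corner) (by simpa only [h] using hw)

lemma setIntegral_sq_Ek_step {m : ℕ} {M : DyadicCube m} {j k : ℤ} (hjk : j ≤ k) (hk : k ≤ M.k)
    {g : (Fin m → ℝ) → ℝ} (hg : BddMeas g) (a : ℝ) :
    ∫ x in dyadicCubeSet M, (Ek j g x - Ek k g x) ^ 2
      = (∫ x in dyadicCubeSet M, (Ek j g x - a) ^ 2)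
        - ∫ x in dyadicCubeSet M, (Ek k g x - a) ^ 2 := by
  have hw : BddMeas fun x => Ek k g x - a := (hg.Ek k).sub (.const a)
  have hwk : ∀ x y, dyadicCubeOf k x = dyadicCubeOf k y → Ek k g x - a = Ek k g y - a :=
    fun x y h => by simp only [Ek, h]
  have h1 := setIntegral_mul_Ek' (hjk.trans hk) hg hw fun x y h => hwk x y (dyadicCubeOf_congr hjk h)
  have h2 := setIntegral_mul_Ek' hk hg hw hwk
  have hi : ∀ {f : (Fin m → ℝ) → ℝ}, BddMeas f → IntegrableOn f (dyadicCubeSet M) volume :=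
    fun hf => hf.integrableOn (volume_dyadicCubeSet_ne_top M)
  have hj' := hi (((hg.Ek j).sub (.const a)).pow_two)
  have hk' := hi hw.pow_two
  have hc1 := hi (hw.mul (hg.Ek j))
  have hc2 := hi (hw.mul (hg.Ek k))
  have e : ∀ x, (Ek j g x - Ek k g x) ^ 2 = ((Ek j g x - a) ^ 2 - (Ek k g x - a) ^ 2)
      - 2 * ((Ek k g x - a) * Ek j g x - (Ek k g x - a) * Ek k g x) := fun x => by ring
  simp only [e]
  have hc : IntegrableOn (fun x => (Ek k g x - a) * Ek j g x - (Ek k g x - a) * Ek k g x)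
      (dyadicCubeSet M) volume := hc1.sub hc2
  have hd : IntegrableOn (fun x => (Ek j g x - a) ^ 2 - (Ek k g x - a) ^ 2)
      (dyadicCubeSet M) volume := hj'.sub hk'
  rw [integral_sub hd (hc.const_mul 2), integral_const_mul, integral_sub hc1 hc2,
    integral_sub hj' hk', h1, h2]
  ring

lemma setIntegral_sq_Ek_le {m : ℕ} {M : DyadicCube m} {k : ℤ} (hk : k ≤ M.k)
    {g : (Fin m → ℝ) → ℝ} (hg : BddMeas g) (a : ℝ) :
    ∫ x in dyadicCubeSet M, (Ek k g x - a) ^ 2 ≤ ∫ x in dyadicCubeSet M, (g x - a) ^ 2 := by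
  have hw : BddMeas fun x => Ek k g x - a := (hg.Ek k).sub (.const a)
  have h2 := setIntegral_mul_Ek' hk hg hw fun x y h => by simp only [Ek, h]
  have hi : ∀ {f : (Fin m → ℝ) → ℝ}, BddMeas f → IntegrableOn f (dyadicCubeSet M) volume :=
    fun hf => hf.integrableOn (volume_dyadicCubeSet_ne_top M)
  have hg' := hi ((hg.sub (.const a)).pow_two)
  have hk' := hi hw.pow_two
  have hc1 := hi (hw.mul hg)
  have hc2 := hi (hw.mul (hg.Ek k))
  have hnn : 0 ≤ ∫ x in dyadicCubeSet M, (g x - Ek k g x) ^ 2 :=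
    integral_nonneg fun x => sq_nonneg _
  have e : ∀ x, (g x - Ek k g x) ^ 2 = ((g x - a) ^ 2 - (Ek k g x - a) ^ 2)
      - 2 * ((Ek k g x - a) * g x - (Ek k g x - a) * Ek k g x) := fun x => by ring
  simp only [e] at hnn
  have hc : IntegrableOn (fun x => (Ek k g x - a) * g x - (Ek k g x - a) * Ek k g x)
      (dyadicCubeSet M) volume := hc1.sub hc2
  have hd : IntegrableOn (fun x => (g x - a) ^ 2 - (Ek k g x - a) ^ 2)
      (dyadicCubeSet M) volume := hg'.sub hk'
  rw [integral_sub hd (hc.const_mul 2), integral_const_mul, integral_sub hc1 hc2,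
    integral_sub hg' hk', h2] at hnn
  linarith

lemma sum_setIntegral_sq_Ek_le {m : ℕ} (M : DyadicCube m)
    {g : (Fin m → ℝ) → ℝ} (hg : BddMeas g) (a : ℝ) (N : ℕ) :
    ∑ t ∈ Finset.range N, ∫ x in dyadicCubeSet M, (Ek (M.k - t - 1) g x - Ek (M.k - t) g x) ^ 2
      ≤ ∫ x in dyadicCubeSet M, (g x - a) ^ 2 := by
  have h : ∀ t : ℕ,
      ∫ x in dyadicCubeSet M, (Ek (M.k - t - 1) g x - Ek (M.k - t) g x) ^ 2
        = (∫ x in dyadicCubeSet M, (Ek (M.k - (t + 1 : ℕ)) g x - a) ^ 2)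
          - ∫ x in dyadicCubeSet M, (Ek (M.k - t) g x - a) ^ 2 := fun t => by
    rw [setIntegral_sq_Ek_step (by omega) (by omega) hg a]
    rw [show M.k - ((t + 1 : ℕ) : ℤ) = M.k - t - 1 by push_cast; ring]
  rw [Finset.sum_congr rfl fun t _ => h t,
    Finset.sum_range_sub fun t : ℕ => ∫ x in dyadicCubeSet M, (Ek (M.k - t) g x - a) ^ 2]
  have h1 := setIntegral_sq_Ek_le (M := M) (k := M.k - N) (by omega) hg a
  have h2 : 0 ≤ ∫ x in dyadicCubeSet M, (Ek (M.k - (0 : ℕ)) g x - a) ^ 2 :=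
    integral_nonneg fun x => sq_nonneg _
  linarith

lemma setLIntegral_ofReal_eq {m : ℕ} (M : DyadicCube m) {f : (Fin m → ℝ) → ℝ} (hf : BddMeas f)
    (h0 : ∀ x, 0 ≤ f x) :
    ∫⁻ x in dyadicCubeSet M, ENNReal.ofReal (f x)
      = ENNReal.ofReal (∫ x in dyadicCubeSet M, f x) :=
  (ofReal_integral_eq_lintegral_ofReal (hf.integrableOn (volume_dyadicCubeSet_ne_top M))
    (Eventually.of_forall h0)).symm

lemma lintegral_sq_deltaQ {m : ℕ} (c : DyadicCube m) (g : (Fin m → ℝ) → ℝ) :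
    ∫⁻ x, ENNReal.ofReal (deltaQ c g x ^ 2)
      = ∫⁻ x in dyadicCubeSet c, ENNReal.ofReal ((Ek (c.k - 1) g x - Ek c.k g x) ^ 2) := by
  rw [← lintegral_indicator (measurableSet_dyadicCubeSet c)]
  refine lintegral_congr fun x => ?_
  by_cases hx : x ∈ dyadicCubeSet c <;> simp [deltaQ, hx]

/-- The martingale differences supported in a dyadic cube `M` are controlled by the `L²` distance
to an arbitrary constant on `M`. -/
lemma sum_lintegral_sq_deltaQ_le {m : ℕ} (M : DyadicCube m) {g : (Fin m → ℝ) → ℝ}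
    (hg : BddMeas g) (a : ℝ) (T : Finset (DyadicCube m))
    (hT : ∀ c ∈ T, c.k ≤ M.k ∧ dyadicCubeSet c ⊆ dyadicCubeSet M) :
    ∑ c ∈ T, ∫⁻ x, ENNReal.ofReal (deltaQ c g x ^ 2)
      ≤ ∫⁻ x in dyadicCubeSet M, ENNReal.ofReal ((g x - a) ^ 2) := by
  classical
  set h : ℤ → (Fin m → ℝ) → ℝ := fun k x => (Ek (k - 1) g x - Ek k g x) ^ 2
  have hh : ∀ k, BddMeas (h k) := fun k => ((hg.Ek _).sub (hg.Ek _)).pow_two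
  obtain ⟨N, hN⟩ : ∃ N : ℕ, ∀ c ∈ T, (M.k - c.k).toNat < N :=
    ⟨T.sup (fun c => (M.k - c.k).toNat) + 1, fun c hc =>
      Nat.lt_succ_of_le (Finset.le_sup (f := fun c : DyadicCube m => (M.k - c.k).toNat) hc)⟩
  calc ∑ c ∈ T, ∫⁻ x, ENNReal.ofReal (deltaQ c g x ^ 2)
      = ∑ t ∈ Finset.range N, ∑ c ∈ T with (M.k - c.k).toNat = t,
          ∫⁻ x, ENNReal.ofReal (deltaQ c g x ^ 2) :=
        (Finset.sum_fiberwise_of_maps_to (fun c hc => Finset.mem_range.2 (hN c hc)) _).symm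
    _ ≤ ∑ t ∈ Finset.range N, ∫⁻ x in dyadicCubeSet M, ENNReal.ofReal (h (M.k - t) x) := by
        refine Finset.sum_le_sum fun t _ => ?_
        have hk : ∀ c ∈ T.filter fun c => (M.k - c.k).toNat = t, c.k = M.k - t := by
          intro c hc
          obtain ⟨hcT, rfl⟩ := Finset.mem_filter.1 hc
          have := (hT c hcT).1
          omega
        have e : ∑ c ∈ T with (M.k - c.k).toNat = t, ∫⁻ x, ENNReal.ofReal (deltaQ c g x ^ 2)
            = ∑ c ∈ T with (M.k - c.k).toNat = t,
                ∫⁻ x in dyadicCubeSet c, ENNReal.ofReal (h (M.k - t) x) :=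
          Finset.sum_congr rfl fun c hc => by rw [lintegral_sq_deltaQ, hk c hc]
        rw [e, ← lintegral_biUnion_finset]
        · exact lintegral_mono_set (Set.iUnion₂_subset fun c hc =>
            (hT c (Finset.mem_filter.1 hc).1).2)
        · intro c hc c' hc' hne
          exact dyadicCubeSet_disjoint_of_ne ((hk c hc).trans (hk c' hc').symm) hne
        · exact fun c _ => measurableSet_dyadicCubeSet c
    _ = ENNReal.ofReal (∑ t ∈ Finset.range N, ∫ x in dyadicCubeSet M, h (M.k - t) x) := by
        rw [ENNReal.ofReal_sum_of_nonneg fun t _ => integral_nonneg fun x => sq_nonneg _]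
        exact Finset.sum_congr rfl fun t _ =>
          setLIntegral_ofReal_eq M (hh _) fun x => sq_nonneg _
    _ ≤ ENNReal.ofReal (∫ x in dyadicCubeSet M, (g x - a) ^ 2) :=
        ENNReal.ofReal_le_ofReal (sum_setIntegral_sq_Ek_le M hg a N)
    _ = _ := (setLIntegral_ofReal_eq M (hg.sub (.const a)).pow_two fun x => sq_nonneg _).symm

/-- If on every cube of a collection `g` is `L²`-close to a constant, up to `ν` of the cube, then
the martingale differences over the collection are controlled by `ν` of its union. -/
lemma tsum_lintegral_sq_deltaQ_le {m : ℕ} {g : (Fin m → ℝ) → ℝ} (hg : BddMeas g)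
    (ν : Measure (Fin m → ℝ)) (C : Set (DyadicCube m))
    (hC : ∀ c ∈ C, ∃ a : ℝ,
      ∫⁻ x in dyadicCubeSet c, ENNReal.ofReal ((g x - a) ^ 2) ≤ ν (dyadicCubeSet c)) :
    ∑' c, C.indicator (fun c => ∫⁻ x, ENNReal.ofReal (deltaQ c g x ^ 2)) c
      ≤ ν (⋃ c ∈ C, dyadicCubeSet c) := by
  classical
  have key : ∀ (N : ℕ) (T : Finset (DyadicCube m)), T.card ≤ N → (∀ c ∈ T, c ∈ C) →
      ∑ c ∈ T, ∫⁻ x, ENNReal.ofReal (deltaQ c g x ^ 2) ≤ ν (⋃ c ∈ T, dyadicCubeSet c) := by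
    intro N
    induction N with
    | zero =>
      intro T hT _
      simp [Finset.card_eq_zero.1 (Nat.le_zero.1 hT)]
    | succ N ih =>
      intro T hT hTC
      rcases T.eq_empty_or_nonempty with rfl | hne
      · simp
      obtain ⟨M, hM, hmax⟩ := T.exists_max_image (fun c => c.k) hne
      obtain ⟨a, ha⟩ := hC M (hTC M hM)
      set T₁ := T.filter fun c => dyadicCubeSet c ⊆ dyadicCubeSet M
      set T₂ := T.filter fun c => ¬ dyadicCubeSet c ⊆ dyadicCubeSet M
      have h1 : ∑ c ∈ T₁, ∫⁻ x, ENNReal.ofReal (deltaQ c g x ^ 2) ≤ ν (dyadicCubeSet M) :=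
        (sum_lintegral_sq_deltaQ_le M hg a T₁ fun c hc =>
          ⟨hmax c (Finset.mem_filter.1 hc).1, (Finset.mem_filter.1 hc).2⟩).trans ha
      have hlt : T₂.card < T.card := Finset.card_lt_card (Finset.filter_ssubset.2
        ⟨M, hM, not_not.2 subset_rfl⟩)
      have h2 := ih T₂ (by omega) fun c hc => hTC c (Finset.mem_filter.1 hc).1
      have hd : Disjoint (⋃ c ∈ T₂, dyadicCubeSet c) (dyadicCubeSet M) := by
        simp only [Set.disjoint_iUnion_left]
        intro c hc
        exact (dyadicCubeSet_subset_or_disjoint (hmax c (Finset.mem_filter.1 hc).1)).resolve_left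
          (Finset.mem_filter.1 hc).2
      calc ∑ c ∈ T, ∫⁻ x, ENNReal.ofReal (deltaQ c g x ^ 2)
          = _ := (Finset.sum_filter_add_sum_filter_not T
            (fun c => dyadicCubeSet c ⊆ dyadicCubeSet M) _).symm
        _ ≤ ν (dyadicCubeSet M) + ν (⋃ c ∈ T₂, dyadicCubeSet c) := add_le_add h1 h2
        _ = ν ((⋃ c ∈ T₂, dyadicCubeSet c) ∪ dyadicCubeSet M) := by
          rw [measure_union hd (measurableSet_dyadicCubeSet M), add_comm]
        _ ≤ ν (⋃ c ∈ T, dyadicCubeSet c) := by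
          refine measure_mono (Set.union_subset (Set.iUnion₂_subset fun c hc => ?_) ?_)
          · exact Set.subset_biUnion_of_mem (u := fun c => dyadicCubeSet c)
              (Finset.mem_filter.1 hc).1
          · exact Set.subset_biUnion_of_mem (u := fun c => dyadicCubeSet c) hM
  rw [ENNReal.tsum_eq_iSup_sum]
  refine iSup_le fun T => ?_
  rw [← Finset.sum_filter_add_sum_filter_not T (· ∈ C)]
  have hz : ∑ c ∈ T with c ∉ C,
      C.indicator (fun c => ∫⁻ x, ENNReal.ofReal (deltaQ c g x ^ 2)) c = 0 :=
    Finset.sum_eq_zero fun c hc => Set.indicator_of_notMem (Finset.mem_filter.1 hc).2 _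
  have he : ∑ c ∈ T with c ∈ C,
      C.indicator (fun c => ∫⁻ x, ENNReal.ofReal (deltaQ c g x ^ 2)) c
      = ∑ c ∈ T with c ∈ C, ∫⁻ x, ENNReal.ofReal (deltaQ c g x ^ 2) :=
    Finset.sum_congr rfl fun c hc => Set.indicator_of_mem (Finset.mem_filter.1 hc).2 _
  rw [hz, he, add_zero]
  refine (key _ _ le_rfl fun c hc => (Finset.mem_filter.1 hc).2).trans (measure_mono ?_)
  exact Set.iUnion₂_subset fun c hc => Set.subset_biUnion_of_mem
    (u := fun c => dyadicCubeSet c) (Finset.mem_filter.1 hc).2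

section Block
variable {d : ℕ} {n : Fin d → ℕ}

lemma measurable_update_block (i : Fin d) :
    Measurable fun p : ProductSpace n × (Fin (n i) → ℝ) => Function.update p.1 i p.2 := by
  refine measurable_pi_lambda _ fun j => ?_
  by_cases h : j = i
  · subst h
    simpa using measurable_snd
  · simp only [Function.update_of_ne h]
    exact (measurable_pi_apply j).comp measurable_fst

lemma measurable_lintegral_block (i : Fin d) {h : ProductSpace n → ℝ≥0∞} (hh : Measurable h) :
    Measurable fun x => ∫⁻ y, h (Function.update x i y) :=
  (hh.comp (measurable_update_block i)).lintegral_prod_right'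

/-- Tonelli's theorem for one block of variables, in terms of `Function.update`. -/
lemma setLIntegral_lintegral_block (i : Fin d) {A : Set (Fin (n i) → ℝ)} (hA : MeasurableSet A)
    {h : ProductSpace n → ℝ≥0∞} (hh : Measurable h) :
    ∫⁻ x in {x | x i ∈ A}, ∫⁻ y, h (Function.update x i y) = volume A * ∫⁻ x, h x := by
  have hA' : MeasurableSet {x : ProductSpace n | x i ∈ A} := measurable_pi_apply i hA
  rw [← lintegral_indicator hA']
  have hm := (measurable_lintegral_block i hh).indicator hA'
  have x₀ : ProductSpace n := fun _ _ => 0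
  change ∫⁻ x, _ ∂(Measure.pi fun _ => volume) = _ * ∫⁻ x, _ ∂(Measure.pi fun _ => volume)
  rw [lintegral_eq_lmarginal_univ x₀, lintegral_eq_lmarginal_univ x₀,
    lmarginal_erase' _ hm (Finset.mem_univ i), lmarginal_erase' _ hh (Finset.mem_univ i)]
  have e : (fun x : ProductSpace n => ∫⁻ z, ({x : ProductSpace n | x i ∈ A}.indicator
      fun x => ∫⁻ y, h (Function.update x i y)) (Function.update x i z))
      = fun x => volume A * ∫⁻ y, h (Function.update x i y) := by
    funext x
    have : ∀ z, ({x : ProductSpace n | x i ∈ A}.indicator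
        fun x => ∫⁻ y, h (Function.update x i y)) (Function.update x i z)
        = A.indicator (fun _ => ∫⁻ y, h (Function.update x i y)) z := fun z => by
      by_cases hz : z ∈ A <;> simp [hz, Set.indicator]
    simp only [this]
    rw [lintegral_indicator hA, setLIntegral_const, mul_comm]
  rw [e]
  exact lintegral_const_mul _ ((measurable_lintegral_block i hh).comp measurable_updateFinset)

lemma lintegral_eq_zero_of_block (i : Fin d) {h : ProductSpace n → ℝ≥0∞} (hh : Measurable h)
    (h0 : ∫⁻ x, h x = 0) : ∀ᵐ x, ∀ᵐ y, h (Function.update x i y) = 0 := by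
  have := setLIntegral_lintegral_block i MeasurableSet.univ hh
  rw [h0, mul_zero] at this
  simp only [Set.mem_univ, Set.ofPred_true, Measure.restrict_univ] at this
  rw [lintegral_eq_zero_iff (measurable_lintegral_block i hh)] at this
  filter_upwards [this] with x hx
  exact (lintegral_eq_zero_iff (f := fun y => h (Function.update x i y))
    (hh.comp (measurable_update x))).1 hx

lemma ae_ae_update {β : Type*} {f g : ProductSpace n → β} (h : f =ᵐ[volume] g) (i : Fin d) :
    ∀ᵐ x, ∀ᵐ y, f (Function.update x i y) = g (Function.update x i y) := by
  obtain ⟨N, hsub, hN, hN0⟩ := exists_measurable_superset_of_null (ae_iff.1 h)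
  have h1 := lintegral_eq_zero_of_block i (h := N.indicator 1) (measurable_one.indicator hN)
    (by rw [lintegral_indicator_one hN, hN0])
  filter_upwards [h1] with x hx
  filter_upwards [hx] with y hy
  by_contra hne
  have : Function.update x i y ∈ N := hsub hne
  simp [this] at hy

/-- An integral inequality may be checked by integrating over one block of variables. -/
lemma lintegral_mono_block (i : Fin d) {f g : ProductSpace n → ℝ≥0∞} (hf : Measurable f)
    (hg : Measurable g)
    (h : ∀ᵐ x, ∫⁻ y, f (Function.update x i y) ≤ ∫⁻ y, g (Function.update x i y)) :
    ∫⁻ x, f x ≤ ∫⁻ x, g x := by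
  set A : Set (Fin (n i) → ℝ) := dyadicCubeSet ⟨0, 0⟩
  have hA : MeasurableSet A := measurableSet_dyadicCubeSet _
  have h1 : volume A = 1 := by simp [A, volume_dyadicCubeSet]
  have ef := setLIntegral_lintegral_block i hA hf
  have eg := setLIntegral_lintegral_block i hA hg
  rw [h1, one_mul] at ef eg
  rw [← ef, ← eg]
  exact lintegral_mono_ae (ae_restrict_of_ae h)

/-- The average of `f` in the `i`-th block over the dyadic cube of generation `k` around `x i`. -/
noncomputable def blockAvg (i : Fin d) (k : ℤ) (f : ProductSpace n → ℝ) (x : ProductSpace n) : ℝ :=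
  Ek k (fun y => f (Function.update x i y)) (x i)

lemma deltaBlock_eq (i : Fin d) (c : DyadicCube (n i)) (f : ProductSpace n → ℝ)
    (x : ProductSpace n) : deltaBlock i c f x
      = (dyadicCubeSet c).indicator (fun _ => (1 : ℝ)) (x i)
        * (blockAvg i (c.k - 1) f x - blockAvg i c.k f x) := by
  unfold deltaBlock deltaQ
  by_cases hx : x i ∈ dyadicCubeSet c <;> simp [hx, blockAvg]

/-- The uniform probability measure on a dyadic cube. -/
noncomputable def cubeMeasure {m : ℕ} (c : DyadicCube m) : Measure (Fin m → ℝ) :=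
  (volume.restrict (dyadicCubeSet c) Set.univ)⁻¹ • volume.restrict (dyadicCubeSet c)

instance {m : ℕ} (c : DyadicCube m) : IsProbabilityMeasure (cubeMeasure c) := by
  constructor
  simp only [cubeMeasure, Measure.smul_apply, smul_eq_mul, Measure.restrict_apply_univ]
  exact ENNReal.inv_mul_cancel (volume_dyadicCubeSet_ne_zero c) (volume_dyadicCubeSet_ne_top c)

lemma blockAvg_eq (i : Fin d) (k : ℤ) (f : ProductSpace n → ℝ) (x : ProductSpace n) :
    blockAvg i k f x = ∫ y, f (Function.update x i y) ∂(cubeMeasure (dyadicCubeOf k (x i))) :=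
  rfl

lemma BddMeas.update {f : ProductSpace n → ℝ} (hf : BddMeas f) (i : Fin d) (x : ProductSpace n) :
    BddMeas fun y => f (Function.update x i y) :=
  hf.comp (measurable_update x)

lemma BddMeas.blockAvg (i : Fin d) (k : ℤ) {f : ProductSpace n → ℝ} (hf : BddMeas f) :
    BddMeas (blockAvg i k f) := by
  constructor
  · have h1 : Measurable fun p : ProductSpace n × (Fin (n i) → ℤ) =>
        ∫ y, f (Function.update p.1 i y) ∂(cubeMeasure ⟨k, p.2⟩) := by
      refine measurable_from_prod_countable_left fun q => ?_
      have hfm := (hf.1.comp (measurable_update_block i)).stronglyMeasurable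
      exact (hfm.integral_prod_right' (ν := cubeMeasure ⟨k, q⟩)).measurable
    have h2 : Measurable fun y : Fin (n i) → ℝ => (dyadicCubeOf k y).j :=
      measurable_comp_dyadicCubeOf k fun c => c.j
    have h3 : Measurable fun x : ProductSpace n => (x, (dyadicCubeOf k (x i)).j) :=
      measurable_id.prodMk (h2.comp (measurable_pi_apply i))
    have e : _root_.blockAvg i k f = fun x => ∫ y, f (Function.update x i y)
        ∂(cubeMeasure ⟨k, (dyadicCubeOf k (x i)).j⟩) := funext (blockAvg_eq i k f)
    have h4 := h1.comp h3
    simp only [Function.comp_def] at h4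
    rw [e]
    exact h4
  · obtain ⟨C, hC⟩ := hf.2
    exact ⟨C, fun x => abs_setAverage_le (fun y => hC _) (volume_dyadicCubeSet_ne_top _)
      (volume_dyadicCubeSet_ne_zero _)⟩

lemma blockAvg_sub (i : Fin d) (k : ℤ) {f g : ProductSpace n → ℝ} (hf : BddMeas f)
    (hg : BddMeas g) (x : ProductSpace n) :
    blockAvg i k (fun x => f x - g x) x = blockAvg i k f x - blockAvg i k g x := by
  simp only [blockAvg_eq]
  exact integral_sub (hf.update i x).integrable (hg.update i x).integrable

lemma blockAvg_mul_of_ne {i j : Fin d} (hij : i ≠ j) (k : ℤ) (u : (Fin (n j) → ℝ) → ℝ)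
    (f : ProductSpace n → ℝ) (x : ProductSpace n) :
    blockAvg i k (fun x => u (x j) * f x) x = u (x j) * blockAvg i k f x := by
  simp only [blockAvg_eq, Function.update_of_ne hij.symm]
  exact integral_const_mul _ _

lemma blockAvg_comm {i j : Fin d} (hij : i ≠ j) (k l : ℤ) {f : ProductSpace n → ℝ}
    (hf : BddMeas f) (x : ProductSpace n) :
    blockAvg i k (blockAvg j l f) x = blockAvg j l (blockAvg i k f) x := by
  simp only [blockAvg_eq, Function.update_of_ne hij.symm, Function.update_of_ne hij]
  rw [integral_integral_swap]
  · refine integral_congr_ae (Eventually.of_forall fun z => ?_)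
    refine integral_congr_ae (Eventually.of_forall fun y => ?_)
    simp only [Function.update_comm hij]
  · have hm : Measurable fun p : (Fin (n i) → ℝ) × (Fin (n j) → ℝ) =>
        Function.update (Function.update x i p.1) j p.2 :=
      (measurable_update_block j).comp
        (((measurable_update x).comp measurable_fst).prodMk measurable_snd)
    exact (hf.comp hm).integrable

lemma BddMeas.indicator_block (i : Fin d) (c : DyadicCube (n i)) :
    BddMeas fun x : ProductSpace n => (dyadicCubeSet c).indicator (fun _ => (1 : ℝ)) (x i) := by
  refine ⟨(measurable_const.indicator (measurableSet_dyadicCubeSet c)).comp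
    (measurable_pi_apply i), 1, fun x => ?_⟩
  by_cases hx : x i ∈ dyadicCubeSet c <;> simp [hx]

lemma BddMeas.deltaBlock (i : Fin d) (c : DyadicCube (n i)) {f : ProductSpace n → ℝ}
    (hf : BddMeas f) : BddMeas (deltaBlock i c f) := by
  rw [funext (deltaBlock_eq i c f)]
  exact (indicator_block i c).mul ((hf.blockAvg i _).sub (hf.blockAvg i _))

lemma deltaBlock_comm {i j : Fin d} (hij : i ≠ j) (c : DyadicCube (n i)) (c' : DyadicCube (n j))
    {f : ProductSpace n → ℝ} (hf : BddMeas f) :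
    deltaBlock i c (deltaBlock j c' f) = deltaBlock j c' (deltaBlock i c f) := by
  have key : ∀ (i j : Fin d), i ≠ j → ∀ (c : DyadicCube (n i)) (c' : DyadicCube (n j)) x,
      deltaBlock i c (deltaBlock j c' f) x =
        (dyadicCubeSet c).indicator (fun _ => (1 : ℝ)) (x i)
        * ((dyadicCubeSet c').indicator (fun _ => (1 : ℝ)) (x j)
          * ((blockAvg i (c.k - 1) (blockAvg j (c'.k - 1) f) x
              - blockAvg i (c.k - 1) (blockAvg j c'.k f) x)
            - (blockAvg i c.k (blockAvg j (c'.k - 1) f) x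
              - blockAvg i c.k (blockAvg j c'.k f) x))) := by
    intro i j hij c c' x
    have e : deltaBlock j c' f = fun x => (dyadicCubeSet c').indicator (fun _ => (1 : ℝ)) (x j)
        * (fun x => blockAvg j (c'.k - 1) f x - blockAvg j c'.k f x) x :=
      funext (deltaBlock_eq j c' f)
    rw [deltaBlock_eq, e, blockAvg_mul_of_ne hij, blockAvg_mul_of_ne hij,
      blockAvg_sub i _ (hf.blockAvg j _) (hf.blockAvg j _),
      blockAvg_sub i _ (hf.blockAvg j _) (hf.blockAvg j _)]
    ring
  funext x
  rw [key i j hij c c' x, key j i hij.symm c' c x]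
  simp only [blockAvg_comm hij _ _ hf x]
  ring

lemma deltaBlock_congr_ae (i : Fin d) (c : DyadicCube (n i)) {f g : ProductSpace n → ℝ}
    (h : f =ᵐ[volume] g) : deltaBlock i c f =ᵐ[volume] deltaBlock i c g := by
  filter_upwards [ae_ae_update h i] with x hx
  have hk : ∀ k, blockAvg i k f x = blockAvg i k g x := fun k => by
    simp only [blockAvg, Ek, average]
    refine integral_congr_ae ?_
    exact Measure.ae_smul_measure (ae_restrict_of_ae hx) _
  rw [deltaBlock_eq, deltaBlock_eq, hk, hk]

/-- The composition of the operators `Δ_{R i}` over a list of blocks. -/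
noncomputable def deltaList (l : List (Fin d)) (R : DyadicRect n) (f : ProductSpace n → ℝ) :
    ProductSpace n → ℝ :=
  l.foldr (fun i g => deltaBlock i (R i) g) f

lemma deltaList_cons (j : Fin d) (l : List (Fin d)) (R : DyadicRect n) (f : ProductSpace n → ℝ) :
    deltaList (j :: l) R f = deltaBlock j (R j) (deltaList l R f) :=
  rfl

lemma BddMeas.deltaList (l : List (Fin d)) (R : DyadicRect n) {f : ProductSpace n → ℝ}
    (hf : BddMeas f) : BddMeas (deltaList l R f) := by
  induction l with
  | nil => exact hf
  | cons j l ih => exact ih.deltaBlock j (R j)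

lemma deltaList_congr_ae (l : List (Fin d)) (R : DyadicRect n) {f g : ProductSpace n → ℝ}
    (h : f =ᵐ[volume] g) : deltaList l R f =ᵐ[volume] deltaList l R g := by
  induction l with
  | nil => exact h
  | cons j l ih => exact deltaBlock_congr_ae j (R j) ih

lemma deltaList_congr (l : List (Fin d)) {R R' : DyadicRect n} (f : ProductSpace n → ℝ)
    (h : ∀ j ∈ l, R j = R' j) : deltaList l R f = deltaList l R' f := by
  induction l with
  | nil => simp only [deltaList, List.foldr_nil]
  | cons j l ih =>
    have h1 := ih fun j hj => h j (List.mem_cons_of_mem _ hj)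
    have h2 := h j List.mem_cons_self
    simp only [deltaList_cons, h1, h2]

lemma deltaBlock_deltaList {l : List (Fin d)} {i : Fin d} (hi : i ∉ l) (R : DyadicRect n)
    {f : ProductSpace n → ℝ} (hf : BddMeas f) :
    deltaBlock i (R i) (deltaList l R f) = deltaList l R (deltaBlock i (R i) f) := by
  induction l with
  | nil => rfl
  | cons j l ih =>
    have hij : i ≠ j := fun h => hi (h ▸ List.mem_cons_self)
    rw [deltaList_cons, deltaList_cons, deltaBlock_comm hij _ _ (hf.deltaList l R),
      ih fun h => hi (List.mem_cons_of_mem _ h)]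

/-- Any one of the operators may be applied first. -/
lemma deltaList_eq_erase {l : List (Fin d)} (hl : l.Nodup) {i : Fin d} (hi : i ∈ l)
    (R : DyadicRect n) {f : ProductSpace n → ℝ} (hf : BddMeas f) :
    deltaList l R f = deltaList (l.erase i) R (deltaBlock i (R i) f) := by
  induction l with
  | nil => simp at hi
  | cons j l ih =>
    obtain ⟨hjl, hl⟩ := List.nodup_cons.1 hl
    by_cases hij : i = j
    · subst hij
      rw [List.erase_cons_head]
      exact deltaBlock_deltaList hjl R hf
    · rw [List.erase_cons_tail (by simpa using Ne.symm hij)]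
      rw [deltaList_cons, deltaList_cons, ih hl ((List.mem_cons.1 hi).resolve_left hij)]

end Block

section Peel
variable {d : ℕ} {n : Fin d → ℕ}

instance (m : ℕ) : MeasurableSpace (DyadicCube m) := ⊤

instance (m : ℕ) : DiscreteMeasurableSpace (DyadicCube m) := ⟨fun _ => trivial⟩

/-- The set of points whose coordinates outside of the blocks `s` lie in a rectangle of the
collection `S` that agrees with `R` on the blocks in `s`. -/
def shadow (S : Set (DyadicRect n)) (s : Finset (Fin d)) (R : DyadicRect n) :
    Set (ProductSpace n) :=
  {x | ∃ R' ∈ S, (∀ j ∈ s, R' j = R j) ∧ ∀ j ∉ s, x j ∈ dyadicCubeSet (R' j)}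

lemma measurableSet_shadow (S : Set (DyadicRect n)) (s : Finset (Fin d)) (R : DyadicRect n) :
    MeasurableSet (shadow S s R) := by
  have e : shadow S s R = ⋃ R' ∈ {R' | R' ∈ S ∧ ∀ j ∈ s, R' j = R j},
      ⋂ j, ⋂ (_ : j ∉ s), {x : ProductSpace n | x j ∈ dyadicCubeSet (R' j)} := by
    ext x
    simp [shadow, and_assoc]
  rw [e]
  refine MeasurableSet.biUnion (Set.to_countable _) fun R' _ => ?_
  exact MeasurableSet.iInter fun j => MeasurableSet.iInter fun _ =>
    measurable_pi_apply j (measurableSet_dyadicCubeSet _)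

lemma update_mem_shadow_iff {S : Set (DyadicRect n)} {s : Finset (Fin d)} {R : DyadicRect n}
    {j : Fin d} (hj : j ∈ s) (x : ProductSpace n) (y : Fin (n j) → ℝ) :
    Function.update x j y ∈ shadow S s R ↔ x ∈ shadow S s R := by
  have : ∀ k ∉ s, Function.update x j y k = x k := fun k hk =>
    Function.update_of_ne (fun h : k = j => hk (h ▸ hj)) _ _
  refine exists_congr fun R' => and_congr_right fun _ => and_congr_right fun _ =>
    forall₂_congr fun k hk => ?_
  rw [this k hk]

lemma update_mem_shadow_of_mem {S : Set (DyadicRect n)} {s : Finset (Fin d)} {R : DyadicRect n}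
    {j : Fin d} (hj : j ∉ s) {c : DyadicCube (n j)} {x : ProductSpace n}
    (hx : x ∈ shadow S (insert j s) (Function.update R j c)) {y : Fin (n j) → ℝ}
    (hy : y ∈ dyadicCubeSet c) : Function.update x j y ∈ shadow S s R := by
  obtain ⟨R', hR', h1, h2⟩ := hx
  refine ⟨R', hR', fun k hk => ?_, fun k hk => ?_⟩
  · rw [h1 k (Finset.mem_insert_of_mem hk), Function.update_of_ne fun h : k = j => hj (h ▸ hk)]
  · by_cases hkj : k = j
    · subst hkj
      rw [h1 k (Finset.mem_insert_self _ _)]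
      simpa using hy
    · rw [Function.update_of_ne hkj]
      exact h2 k (by simp [hkj, hk])

/-- Summing a square function over one block: if, in almost every fibre, the martingale
differences are summed over the cubes `C x` only, and the function is close to constants there,
then the sum is controlled by integrating `w` over the union of these cubes. -/
lemma tsum_lintegral_sq_deltaBlock_le {j : Fin d} {G : ProductSpace n → ℝ} (hG : BddMeas G)
    (U : DyadicCube (n j) → Set (ProductSpace n)) (hU : ∀ c, MeasurableSet (U c))
    (hUj : ∀ c x y, Function.update x j y ∈ U c ↔ x ∈ U c)
    {w : ProductSpace n → ℝ≥0∞} (hw : Measurable w)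
    {V : Set (ProductSpace n)} (hV : MeasurableSet V)
    (hUV : ∀ c, ∀ x ∈ U c, ∀ y ∈ dyadicCubeSet c, Function.update x j y ∈ V)
    (h : ∀ᵐ x, ∀ c, x ∈ U c → ∃ a : ℝ,
      ∫⁻ y in dyadicCubeSet c, ENNReal.ofReal ((G (Function.update x j y) - a) ^ 2)
        ≤ ∫⁻ y in dyadicCubeSet c, w (Function.update x j y)) :
    ∑' c, ∫⁻ x, (U c).indicator (fun x => ENNReal.ofReal (deltaBlock j c G x ^ 2)) x
      ≤ ∫⁻ x, V.indicator w x := by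
  have hm : ∀ c, Measurable
      ((U c).indicator fun x => ENNReal.ofReal (deltaBlock j c G x ^ 2)) := fun c =>
    ((hG.deltaBlock j c).1.pow_const 2).ennreal_ofReal.indicator (hU c)
  rw [← lintegral_tsum fun c => (hm c).aemeasurable]
  refine lintegral_mono_block j (Measurable.tsum hm) (hw.indicator hV) ?_
  filter_upwards [h] with x hx
  have hmx : ∀ c, Measurable fun y => ((U c).indicator
      fun x => ENNReal.ofReal (deltaBlock j c G x ^ 2)) (Function.update x j y) := fun c =>
    (hm c).comp (measurable_update x)
  rw [lintegral_tsum fun c => (hmx c).aemeasurable]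
  set ν : Measure (Fin (n j) → ℝ) := volume.withDensity fun y => w (Function.update x j y)
  set g : (Fin (n j) → ℝ) → ℝ := fun y => G (Function.update x j y)
  have key := tsum_lintegral_sq_deltaQ_le (hG.update j x) ν {c | x ∈ U c} fun c hc => by
    obtain ⟨a, ha⟩ := hx c hc
    refine ⟨a, ha.trans_eq ?_⟩
    rw [withDensity_apply _ (measurableSet_dyadicCubeSet c)]
  have hl : ∀ c, ∫⁻ y, (U c).indicator (fun x => ENNReal.ofReal (deltaBlock j c G x ^ 2))
      (Function.update x j y)
      = {c | x ∈ U c}.indicator (fun c => ∫⁻ y, ENNReal.ofReal (deltaQ c g y ^ 2)) c := by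
    intro c
    by_cases hc : x ∈ U c
    · rw [Set.indicator_of_mem (show c ∈ {c | x ∈ U c} from hc)]
      refine lintegral_congr fun y => ?_
      rw [Set.indicator_of_mem ((hUj c x y).2 hc)]
      simp [deltaBlock, g]
    · rw [Set.indicator_of_notMem (show c ∉ {c | x ∈ U c} from hc)]
      refine (lintegral_congr fun y => ?_).trans lintegral_zero
      rw [Set.indicator_of_notMem (mt (hUj c x y).1 hc)]
  simp only [hl]
  refine key.trans ?_
  have hmeas : MeasurableSet (⋃ c ∈ {c | x ∈ U c}, dyadicCubeSet c) :=
    MeasurableSet.biUnion (Set.to_countable _) fun c _ => measurableSet_dyadicCubeSet c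
  rw [withDensity_apply _ hmeas, ← lintegral_indicator hmeas]
  refine lintegral_mono fun y => ?_
  by_cases hy : y ∈ ⋃ c ∈ {c | x ∈ U c}, dyadicCubeSet c
  · obtain ⟨c, hc, hyc⟩ := Set.mem_iUnion₂.1 hy
    rw [Set.indicator_of_mem hy, Set.indicator_of_mem (hUV c x hc y hyc)]
  · rw [Set.indicator_of_notMem hy]
    exact zero_le

/-- All blocks but the `i`-th may be summed by Bessel's inequality. -/
lemma lmarginal_lintegral_sq_deltaList_le (S : Set (DyadicRect n)) (i : Fin d)
    {f : ProductSpace n → ℝ} (hf : BddMeas f) (l : List (Fin d)) (hl : l.Nodup) (hi : i ∉ l)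
    (R : DyadicRect n) :
    (∫⋯∫⁻_l.toFinset, (fun R : DyadicRect n =>
        ∫⁻ x, (shadow S (insert i l.toFinset) R).indicator
          (fun x => ENNReal.ofReal (deltaList l R (deltaBlock i (R i) f) x ^ 2)) x)
        ∂(fun _ => Measure.count)) R
      ≤ ∫⁻ x, (shadow S {i} R).indicator
          (fun x => ENNReal.ofReal (deltaBlock i (R i) f x ^ 2)) x := by
  induction l with
  | nil => simp [deltaList]
  | cons j l ih =>
    obtain ⟨hjl, hl⟩ := List.nodup_cons.1 hl
    have hij : i ≠ j := fun h => hi (h ▸ List.mem_cons_self)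
    have hil : i ∉ l := fun h => hi (List.mem_cons_of_mem _ h)
    refine le_trans ?_ (ih hl hil)
    rw [List.toFinset_cons, lmarginal_insert' _ (measurable_of_countable _) (by simpa using hjl)]
    refine lmarginal_mono (fun R => ?_) R
    simp only
    rw [lintegral_count]
    have hG := (hf.deltaBlock i (R i)).deltaList l R
    have e : ∀ c, deltaList (j :: l) (Function.update R j c)
        (deltaBlock i (Function.update R j c i) f)
        = deltaBlock j c (deltaList l R (deltaBlock i (R i) f)) := fun c => by
      rw [deltaList_cons, Function.update_self, Function.update_of_ne hij]
      rw [deltaList_congr l _ fun k hk =>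
        Function.update_of_ne (fun h : k = j => hjl (h ▸ hk)) _ _]
    simp only [e]
    refine tsum_lintegral_sq_deltaBlock_le hG _ (fun c => measurableSet_shadow _ _ _)
      (fun c x y => update_mem_shadow_iff (by simp) x y) (hG.1.pow_const 2).ennreal_ofReal
      (measurableSet_shadow _ _ _) (fun c x hx y hy => ?_)
      (Eventually.of_forall fun x c _ => ⟨0, by simp⟩)
    rw [Finset.insert_comm] at hx
    exact update_mem_shadow_of_mem (by simp [hij.symm, hjl]) hx hy

/-- Summation over all rectangles of a collection reduces to the `i`-th block. -/
lemma tsum_lintegral_sq_deltaList_le (S : Set (DyadicRect n)) (i : Fin d)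
    {f : ProductSpace n → ℝ} (hf : BddMeas f) (R₀ : DyadicRect n) :
    ∑' R, S.indicator (fun R => ∫⁻ x,
        ENNReal.ofReal (deltaList (List.finRange d) R f x ^ 2)) R
      ≤ ∑' c, ∫⁻ x, (shadow S {i} (Function.update R₀ i c)).indicator
          (fun x => ENNReal.ofReal (deltaBlock i c f x ^ 2)) x := by
  set l := (List.finRange d).erase i
  have hl : l.Nodup := (List.nodup_finRange d).erase i
  have hil : i ∉ l := (List.nodup_finRange d).not_mem_erase
  have hu : insert i l.toFinset = Finset.univ := by
    ext j
    by_cases hj : j = i <;> simp [hj, l, (List.nodup_finRange d).mem_erase_iff]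
  set F : DyadicRect n → ℝ≥0∞ := fun R => ∫⁻ x, (shadow S (insert i l.toFinset) R).indicator
    (fun x => ENNReal.ofReal (deltaList l R (deltaBlock i (R i) f) x ^ 2)) x
  have hF : ∀ R, S.indicator (fun R => ∫⁻ x,
      ENNReal.ofReal (deltaList (List.finRange d) R f x ^ 2)) R = F R := by
    intro R
    simp only [F, hu]
    by_cases hR : R ∈ S
    · have : shadow S Finset.univ R = Set.univ :=
        Set.eq_univ_of_forall fun x => ⟨R, hR, fun _ _ => rfl, by simp⟩
      rw [Set.indicator_of_mem hR, this, Set.indicator_univ,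
        deltaList_eq_erase (List.nodup_finRange d) (List.mem_finRange i) R hf]
    · have : shadow S Finset.univ R = ∅ := by
        refine Set.eq_empty_of_forall_notMem fun x ⟨R', hR', h, _⟩ => hR ?_
        rwa [← funext fun j => h j (Finset.mem_univ j)]
      rw [Set.indicator_of_notMem hR, this]
      simp
  have hsum : ∑' R, F R = ∫⁻ R, F R ∂(Measure.pi fun _ => Measure.count) := by
    rw [lintegral_countable']
    simp
  simp only [hF]
  rw [hsum, lintegral_eq_lmarginal_univ R₀, ← hu,
    lmarginal_insert _ (measurable_of_countable _) (by simpa using hil), lintegral_count]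
  refine ENNReal.tsum_le_tsum fun c => ?_
  simpa using lmarginal_lintegral_sq_deltaList_le S i hf l hl hil (Function.update R₀ i c)

end Peel

section Slices
variable {d : ℕ} {n : Fin d → ℕ}

lemma cubeSet_eq_pi {m : ℕ} (c : Cube m) :
    cubeSet c = Set.univ.pi fun i => Set.Ico (c.corner i) (c.corner i + c.side) := by
  ext x
  simp [cubeSet]

lemma measurableSet_cubeSet {m : ℕ} (c : Cube m) : MeasurableSet (cubeSet c) := by
  rw [cubeSet_eq_pi]
  exact MeasurableSet.univ_pi fun i => measurableSet_Ico

lemma volume_cubeSet {m : ℕ} (c : Cube m) :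
    volume (cubeSet c) = ENNReal.ofReal c.side ^ m := by
  rw [cubeSet_eq_pi, Real.volume_pi_Ico]
  simp

lemma rectSet_eq_pi (R : Rect n) : rectSet R = Set.univ.pi fun i => cubeSet (R i) := by
  ext x
  simp [rectSet]

lemma measurableSet_rectSet (R : Rect n) : MeasurableSet (rectSet R) := by
  rw [rectSet_eq_pi]
  exact MeasurableSet.univ_pi fun i => measurableSet_cubeSet _

lemma volume_rectSet (R : Rect n) : volume (rectSet R) = ∏ i, volume (cubeSet (R i)) := by
  rw [rectSet_eq_pi]
  exact volume_pi_pi _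

lemma volume_rectSet_ne_top (R : Rect n) : volume (rectSet R) ≠ ∞ := by
  simp only [volume_rectSet, volume_cubeSet]
  exact ENNReal.prod_ne_top fun i _ => ENNReal.pow_ne_top ENNReal.ofReal_ne_top

lemma volume_rectSet_ne_zero (R : Rect n) : volume (rectSet R) ≠ 0 := by
  simp only [volume_rectSet, volume_cubeSet]
  refine Finset.prod_ne_zero_iff.2 fun i _ => pow_ne_zero _ ?_
  simpa using (R i).side_pos

/-- A dyadic cube viewed as a cube. -/
noncomputable def DyadicCube.toCube {m : ℕ} (c : DyadicCube m) : Cube m :=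
  ⟨c.corner, 2 ^ c.k, by positivity⟩

lemma cubeSet_toCube {m : ℕ} (c : DyadicCube m) : cubeSet c.toCube = dyadicCubeSet c := by
  ext x
  simp [cubeSet, dyadicCubeSet, DyadicCube.toCube, DyadicCube.corner, add_mul]

lemma setLIntegral_sub_average_sq_le_bmo2 (b : ProductSpace n → ℝ) (R : Rect n) :
    ∫⁻ x in rectSet R, ENNReal.ofReal ((b x - ⨍ y in rectSet R, b y) ^ 2)
      ≤ bmo2 b ^ 2 * volume (rectSet R) := by
  have h := le_iSup (fun R : Rect n => ((volume (rectSet R))⁻¹ *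
      ∫⁻ x in rectSet R, ENNReal.ofReal ((b x - ⨍ y in rectSet R, b y) ^ 2)) ^ (1 / 2 : ℝ)) R
  have h2 := pow_le_pow_left₀ (zero_le) h 2
  rw [← ENNReal.rpow_mul_natCast] at h2
  norm_num at h2
  rw [mul_comm (volume _)⁻¹, ← div_eq_mul_inv, ENNReal.div_le_iff (volume_rectSet_ne_zero R)
    (volume_rectSet_ne_top R)] at h2
  exact h2

lemma bmo2_congr_ae {b b' : ProductSpace n → ℝ} (h : b =ᵐ[volume] b') : bmo2 b = bmo2 b' := by
  unfold bmo2
  refine iSup_congr fun R => ?_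
  have hR := ae_restrict_of_ae (s := rectSet R) h
  have e : ⨍ y in rectSet R, b y = ⨍ y in rectSet R, b' y := by
    rw [setAverage_eq, setAverage_eq, integral_congr_ae hR]
  rw [e]
  congr 2
  refine lintegral_congr_ae ?_
  filter_upwards [hR] with x hx
  rw [hx]

/-- The mean minimizes the `L²` distance to constants. -/
lemma setLIntegral_sub_average_sq_le {m : ℕ} (c : DyadicCube m) {u : (Fin m → ℝ) → ℝ}
    (hu : BddMeas u) (a : ℝ) :
    ∫⁻ y in dyadicCubeSet c, ENNReal.ofReal ((u y - ⨍ z in dyadicCubeSet c, u z) ^ 2)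
      ≤ ∫⁻ y in dyadicCubeSet c, ENNReal.ofReal ((u y - a) ^ 2) := by
  set e := ⨍ z in dyadicCubeSet c, u z with he
  have : IsFiniteMeasure (volume.restrict (dyadicCubeSet c)) :=
    ⟨by simpa using (volume_dyadicCubeSet_ne_top c).lt_top⟩
  rw [setLIntegral_ofReal_eq c (hu.sub (.const e)).pow_two fun _ => sq_nonneg _,
    setLIntegral_ofReal_eq c (hu.sub (.const a)).pow_two fun _ => sq_nonneg _]
  refine ENNReal.ofReal_le_ofReal ?_
  have h0 : ∫ y in dyadicCubeSet c, (u y - e) = 0 := integral_sub_average _ _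
  have hi1 : IntegrableOn (fun y => (u y - e) ^ 2) (dyadicCubeSet c) volume :=
    (hu.sub (.const e)).pow_two.integrable
  have hi2 : IntegrableOn (fun y => 2 * (e - a) * (u y - e)) (dyadicCubeSet c) volume :=
    ((hu.sub (.const e)).integrable).const_mul _
  have hi3 : IntegrableOn (fun _ => (e - a) ^ 2) (dyadicCubeSet c) volume :=
    (BddMeas.const _).integrable
  have hx : ∀ y, (u y - a) ^ 2 = (u y - e) ^ 2 + (2 * (e - a) * (u y - e) + (e - a) ^ 2) :=
    fun y => by ring
  simp only [hx]
  have hi23 : IntegrableOn (fun y => 2 * (e - a) * (u y - e) + (e - a) ^ 2)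
      (dyadicCubeSet c) volume := hi2.add hi3
  rw [integral_add hi1 hi23, integral_add hi2 hi3, integral_const_mul, h0, mul_zero, zero_add]
  have : 0 ≤ ∫ y in dyadicCubeSet c, (e - a) ^ 2 := integral_nonneg fun _ => sq_nonneg _
  linarith

lemma BddMeas.setAverage_block (i : Fin d) (c : DyadicCube (n i)) {b : ProductSpace n → ℝ}
    (hb : BddMeas b) :
    BddMeas fun x => ⨍ z in dyadicCubeSet c, b (Function.update x i z) := by
  constructor
  · have hfm := (hb.1.comp (measurable_update_block i)).stronglyMeasurable
    exact (hfm.integral_prod_right' (ν := cubeMeasure c)).measurable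
  · obtain ⟨C, hC⟩ := hb.2
    exact ⟨C, fun x => abs_setAverage_le (fun y => hC _) (volume_dyadicCubeSet_ne_top _)
      (volume_dyadicCubeSet_ne_zero _)⟩

/-- The squared deviation of `b` from its means over the slices in the `i`-th block. -/
noncomputable def sliceDev (i : Fin d) (c : DyadicCube (n i)) (b : ProductSpace n → ℝ)
    (x : ProductSpace n) : ℝ≥0∞ :=
  ENNReal.ofReal ((b x - ⨍ z in dyadicCubeSet c, b (Function.update x i z)) ^ 2)

lemma measurable_sliceDev (i : Fin d) (c : DyadicCube (n i)) {b : ProductSpace n → ℝ}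
    (hb : BddMeas b) : Measurable (sliceDev i c b) :=
  (hb.sub (hb.setAverage_block i c)).pow_two.1.ennreal_ofReal

lemma update_mem_rectSet_iff {R : Rect n} {i : Fin d} {Q : Cube (n i)} {x : ProductSpace n}
    {y : Fin (n i) → ℝ} : Function.update x i y ∈ rectSet (Function.update R i Q)
      ↔ y ∈ cubeSet Q ∧ ∀ j ≠ i, x j ∈ cubeSet (R j) := by
  constructor
  · intro h
    refine ⟨by simpa using h i, fun j hj => by simpa [hj] using h j⟩
  · rintro ⟨h1, h2⟩ j
    by_cases hj : j = i
    · subst hj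
      simpa using h1
    · simpa [hj] using h2 j hj

lemma setLIntegral_sliceDev_le (i : Fin d) (c : DyadicCube (n i)) {b : ProductSpace n → ℝ}
    (hb : BddMeas b) (R : Rect n) :
    ∫⁻ x in rectSet (Function.update R i c.toCube), sliceDev i c b x
      ≤ bmo2 b ^ 2 * volume (rectSet (Function.update R i c.toCube)) := by
  set W := rectSet (Function.update R i c.toCube)
  have hW : MeasurableSet W := measurableSet_rectSet _
  refine le_trans ?_ (setLIntegral_sub_average_sq_le_bmo2 b _)
  set a := ⨍ y in W, b y
  rw [← lintegral_indicator hW, ← lintegral_indicator hW]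
  refine lintegral_mono_block i ((measurable_sliceDev i c hb).indicator hW)
    (((hb.sub (.const a)).pow_two.1.ennreal_ofReal).indicator hW) (Eventually.of_forall fun x => ?_)
  by_cases hx : ∀ j ≠ i, x j ∈ cubeSet (R j)
  · have e : ∀ (h : ProductSpace n → ℝ≥0∞) (y : Fin (n i) → ℝ),
        W.indicator h (Function.update x i y)
          = (dyadicCubeSet c).indicator (fun y => h (Function.update x i y)) y := by
      intro h y
      have := update_mem_rectSet_iff (R := R) (Q := c.toCube) (x := x) (y := y)
      rw [cubeSet_toCube] at this
      by_cases hy : y ∈ dyadicCubeSet c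
      · rw [Set.indicator_of_mem hy, Set.indicator_of_mem (this.2 ⟨hy, hx⟩)]
      · rw [Set.indicator_of_notMem hy, Set.indicator_of_notMem (fun h => hy (this.1 h).1)]
    simp only [e]
    rw [lintegral_indicator (measurableSet_dyadicCubeSet c),
      lintegral_indicator (measurableSet_dyadicCubeSet c)]
    simp only [sliceDev, Function.update_idem]
    exact setLIntegral_sub_average_sq_le c (hb.update i x) a
  · have e : ∀ (h : ProductSpace n → ℝ≥0∞) (y : Fin (n i) → ℝ),
        W.indicator h (Function.update x i y) = 0 := fun h y =>
      Set.indicator_of_notMem (fun hy => hx (update_mem_rectSet_iff.1 hy).2) _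
    simp [e]

lemma volume_rectSet_update (R : Rect n) (i : Fin d) (Q : Cube (n i)) :
    volume (cubeSet (R i)) * volume (rectSet (Function.update R i Q))
      = volume (cubeSet Q) * volume (rectSet R) := by
  rw [volume_rectSet, volume_rectSet, ← Finset.mul_prod_erase _ _ (Finset.mem_univ i),
    ← Finset.mul_prod_erase _ (fun i => volume (cubeSet (R i))) (Finset.mem_univ i),
    Function.update_self]
  rw [Finset.prod_congr rfl fun j hj => by
    rw [Function.update_of_ne (Finset.ne_of_mem_erase hj)]]
  ring

lemma setLIntegral_setLIntegral_sliceDev_le (i : Fin d) (c : DyadicCube (n i))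
    {b : ProductSpace n → ℝ} (hb : BddMeas b) (R : Rect n) :
    ∫⁻ x in rectSet R, ∫⁻ y in dyadicCubeSet c, sliceDev i c b (Function.update x i y)
      ≤ bmo2 b ^ 2 * volume (dyadicCubeSet c) * volume (rectSet R) := by
  set W := rectSet (Function.update R i c.toCube)
  have hW : MeasurableSet W := measurableSet_rectSet _
  have key := setLIntegral_lintegral_block i (measurableSet_cubeSet (R i))
    ((measurable_sliceDev i c hb).indicator hW)
  have hm : MeasurableSet {x : ProductSpace n | x i ∈ cubeSet (R i)} :=
    measurable_pi_apply i (measurableSet_cubeSet (R i))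
  rw [lintegral_indicator hW, ← lintegral_indicator hm] at key
  have e : ∫⁻ x in rectSet R, ∫⁻ y in dyadicCubeSet c, sliceDev i c b (Function.update x i y)
      = volume (cubeSet (R i)) * ∫⁻ x in W, sliceDev i c b x := by
    rw [← key, ← lintegral_indicator (measurableSet_rectSet R)]
    refine lintegral_congr fun x => ?_
    have hWx := fun y => update_mem_rectSet_iff (R := R) (Q := c.toCube) (x := x) (y := y)
    simp only [cubeSet_toCube] at hWx
    by_cases hx : x ∈ rectSet R
    · rw [Set.indicator_of_mem hx,
        Set.indicator_of_mem (show x ∈ {x : ProductSpace n | x i ∈ cubeSet (R i)} from hx i),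
        ← lintegral_indicator (measurableSet_dyadicCubeSet c)]
      refine lintegral_congr fun y => ?_
      by_cases hy : y ∈ dyadicCubeSet c
      · rw [Set.indicator_of_mem hy, Set.indicator_of_mem ((hWx y).2 ⟨hy, fun j _ => hx j⟩)]
      · rw [Set.indicator_of_notMem hy, Set.indicator_of_notMem (fun h => hy ((hWx y).1 h).1)]
    · rw [Set.indicator_of_notMem hx]
      by_cases hxi : x i ∈ cubeSet (R i)
      · rw [Set.indicator_of_mem (show x ∈ {x : ProductSpace n | x i ∈ cubeSet (R i)} from hxi)]
        refine (lintegral_zero.symm.trans (lintegral_congr fun y => ?_))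
        refine (Set.indicator_of_notMem (fun h => hx fun j => ?_) _).symm
        by_cases hj : j = i
        · exact hj ▸ hxi
        · exact ((hWx y).1 h).2 j hj
      · rw [Set.indicator_of_notMem (show x ∉ {x : ProductSpace n | x i ∈ cubeSet (R i)} from hxi)]
  rw [e]
  calc volume (cubeSet (R i)) * ∫⁻ x in W, sliceDev i c b x
      ≤ volume (cubeSet (R i)) * (bmo2 b ^ 2 * volume W) := by
        gcongr
        exact setLIntegral_sliceDev_le i c hb R
    _ = bmo2 b ^ 2 * (volume (cubeSet (R i)) * volume W) := by ring
    _ = _ := by rw [volume_rectSet_update, cubeSet_toCube, mul_assoc]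

lemma exists_rectSet_ae_eq_closedBall (x : ProductSpace n) {r : ℝ} (hr : 0 < r) :
    ∃ R : Rect n, rectSet R =ᵐ[volume] Metric.closedBall x r := by
  refine ⟨fun j => ⟨fun a => x j a - r, 2 * r, by positivity⟩, ?_⟩
  refine ae_eq_of_subset_of_measure_ge ?_ (le_of_eq ?_)
    (measurableSet_rectSet _).nullMeasurableSet ?_
  · intro z hz
    rw [Metric.mem_closedBall, dist_pi_le_iff hr.le]
    intro j
    rw [dist_pi_le_iff hr.le]
    intro a
    have := hz j a
    simp only at this
    rw [Real.dist_eq, abs_le]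
    constructor <;> linarith
  · rw [volume_rectSet, closedBall_pi _ hr.le, volume_pi_pi]
    refine Finset.prod_congr rfl fun j _ => ?_
    rw [volume_cubeSet, Real.volume_pi_closedBall _ hr.le]
    simp [ENNReal.ofReal_pow hr.le, mul_pow, ENNReal.ofReal_mul]
  · exact measure_closedBall_lt_top.ne

/-- Almost all slices of `b` in the `i`-th block have bounded mean oscillation. -/
lemma ae_setLIntegral_sliceDev_le (i : Fin d) (c : DyadicCube (n i)) {b : ProductSpace n → ℝ}
    (hb : BddMeas b) :
    ∀ᵐ x, ∫⁻ y in dyadicCubeSet c, sliceDev i c b (Function.update x i y)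
      ≤ bmo2 b ^ 2 * volume (dyadicCubeSet c) := by
  set F : ProductSpace n → ℝ≥0∞ := fun x =>
    ∫⁻ y in dyadicCubeSet c, sliceDev i c b (Function.update x i y)
  have hF : Measurable F :=
    ((measurable_sliceDev i c hb).comp (measurable_update_block i)).lintegral_prod_right'
  obtain ⟨C, hC⟩ := (hb.sub (hb.setAverage_block i c)).pow_two.2
  have hFle : ∀ x, F x ≤ ENNReal.ofReal C * volume (dyadicCubeSet c) := fun x => by
    rw [← setLIntegral_const]
    exact lintegral_mono fun y => ENNReal.ofReal_le_ofReal ((le_abs_self _).trans (hC _))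
  set ρ : Measure (ProductSpace n) := volume.withDensity F
  have hρ : ρ ≤ (ENNReal.ofReal C * volume (dyadicCubeSet c)).toNNReal •
      (volume : Measure (ProductSpace n)) := by
    have h := withDensity_mono (μ := (volume : Measure (ProductSpace n)))
      (Eventually.of_forall hFle)
    rw [withDensity_const] at h
    refine h.trans_eq ?_
    conv_lhs => rw [← ENNReal.coe_toNNReal
      (ENNReal.mul_ne_top (ENNReal.ofReal_ne_top (r := C)) (volume_dyadicCubeSet_ne_top c))]
    rfl
  have : IsLocallyFiniteMeasure ρ :=
    Measure.isLocallyFiniteMeasure_of_le hρ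
  filter_upwards [Besicovitch.ae_tendsto_rnDeriv ρ volume, Measure.rnDeriv_withDensity volume hF]
    with x hx hxF
  rw [hxF] at hx
  refine le_of_tendsto hx ?_
  filter_upwards [self_mem_nhdsWithin] with r hr
  obtain ⟨R, hR⟩ := exists_rectSet_ae_eq_closedBall x hr
  rw [← measure_congr hR, ← measure_congr ((withDensity_absolutelyContinuous _ F).ae_eq hR),
    withDensity_apply _ (measurableSet_rectSet R)]
  rw [ENNReal.div_le_iff (volume_rectSet_ne_zero R) (volume_rectSet_ne_top R)]
  exact setLIntegral_setLIntegral_sliceDev_le i c hb R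

end Slices

section Final
variable {d : ℕ} {n : Fin d → ℕ}

lemma DyadicCube.norm_sub_le {m : ℕ} {c : DyadicCube m} {y y' : Fin m → ℝ}
    (hy : y ∈ dyadicCubeSet c) (hy' : y' ∈ dyadicCubeSet c) : ‖y - y'‖ ≤ 2 ^ c.k := by
  rw [pi_norm_le_iff_of_nonneg (by positivity)]
  intro a
  have h := hy a
  have h' := hy' a
  rw [Pi.sub_apply, Real.norm_eq_abs, abs_le]
  constructor <;> linarith

/-- Functions with block gradients bounded by `1` in `ℓ¹` are `1`-Lipschitz in each block. -/
lemma abs_sub_update_le {φ : ProductSpace n → ℝ} (hφ : ContDiff ℝ 1 φ) {i : Fin d}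
    (hφgrad : ∀ x, ∑ j, |fderiv ℝ φ x (Pi.single i (Pi.single j (1 : ℝ)))| ≤ 1)
    (x : ProductSpace n) (y y' : Fin (n i) → ℝ) :
    |φ (Function.update x i y) - φ (Function.update x i y')| ≤ ‖y - y'‖ := by
  have hs : ContinuousLinearMap.pi (Pi.single i (ContinuousLinearMap.id ℝ (Fin (n i) → ℝ)))
      = ContinuousLinearMap.single ℝ (fun i => Fin (n i) → ℝ) i := by
    ext v j a
    by_cases hj : j = i
    · subst hj
      simp
    · simp [hj]
  have hd : ∀ z, HasFDerivAt (fun y => φ (Function.update x i y))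
      ((fderiv ℝ φ (Function.update x i z)).comp
        (ContinuousLinearMap.single ℝ (fun i => Fin (n i) → ℝ) i)) z := fun z =>
    ((hφ.differentiable one_ne_zero) _).hasFDerivAt.comp z (hs ▸ hasFDerivAt_update x z)
  have h := Convex.norm_image_sub_le_of_norm_hasFDerivWithin_le (C := 1) (s := Set.univ)
    (fun z _ => (hd z).hasFDerivWithinAt) (fun z _ => ?_) convex_univ
    (Set.mem_univ y') (Set.mem_univ y)
  · simpa using h
  refine ContinuousLinearMap.opNorm_le_bound _ zero_le_one fun v => ?_
  set L := (fderiv ℝ φ (Function.update x i z)).comp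
    (ContinuousLinearMap.single ℝ (fun i => Fin (n i) → ℝ) i)
  have hv : L v = ∑ j, v j * L (Pi.single j 1) := by
    conv_lhs => rw [← Finset.univ_sum_single v, map_sum]
    refine Finset.sum_congr rfl fun j _ => ?_
    rw [← smul_eq_mul, ← map_smul, ← Pi.single_smul, smul_eq_mul, mul_one]
  have hL : ∀ j, L (Pi.single j 1) =
      fderiv ℝ φ (Function.update x i z) (Pi.single i (Pi.single j (1 : ℝ))) := fun j => rfl
  rw [hv]
  calc ‖∑ j, v j * L (Pi.single j 1)‖ ≤ ∑ j, ‖v‖ * |L (Pi.single j 1)| := by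
        refine (norm_sum_le _ _).trans (Finset.sum_le_sum fun j _ => ?_)
        rw [norm_mul]
        exact mul_le_mul_of_nonneg_right (norm_le_pi_norm v j) (norm_nonneg _)
    _ = ‖v‖ * ∑ j, |L (Pi.single j 1)| := by rw [Finset.mul_sum]
    _ ≤ ‖v‖ * 1 := by
        simp only [hL]
        gcongr
        exact hφgrad _
    _ = 1 * ‖v‖ := mul_comm _ _

lemma sq_mul_sub_mul_le {p q u v ε : ℝ} (hp : |p| ≤ 1) (hv : |v| ≤ 1) (h : |p - q| ≤ ε) :
    (p * u - q * v) ^ 2 ≤ 2 * ((u - v) ^ 2 + ε ^ 2) := by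
  have h1 : p ^ 2 ≤ 1 := by rw [← sq_abs]; nlinarith [abs_nonneg p]
  have h2 : v ^ 2 ≤ 1 := by rw [← sq_abs]; nlinarith [abs_nonneg v]
  have h3 : (p - q) ^ 2 ≤ ε ^ 2 := by rw [← sq_abs]; gcongr
  have h4 : (p * (u - v)) ^ 2 ≤ (u - v) ^ 2 := by rw [mul_pow]; nlinarith [sq_nonneg (u - v)]
  have h5 : ((p - q) * v) ^ 2 ≤ ε ^ 2 := by
    rw [mul_pow]; nlinarith [sq_nonneg (p - q), sq_nonneg v]
  nlinarith [sq_nonneg (p * (u - v) - (p - q) * v)]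

/-- On small cubes in the `i`-th block, almost every slice of `φ * b` is close to a constant. -/
lemma ae_forall_exists_setLIntegral_sq_le {φ b : ProductSpace n → ℝ} (hφ : ContDiff ℝ 1 φ)
    (hφ1 : ∀ x, |φ x| ≤ 1) {i : Fin d}
    (hφgrad : ∀ x, ∑ j, |fderiv ℝ φ x (Pi.single i (Pi.single j (1 : ℝ)))| ≤ 1)
    (hb : Measurable b) (hb1 : ∀ x, |b x| ≤ 1) (ε : ℝ) :
    ∀ᵐ x, ∀ c : DyadicCube (n i), (2 : ℝ) ^ c.k ≤ ε → ∃ a : ℝ,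
      ∫⁻ y in dyadicCubeSet c, ENNReal.ofReal
          ((φ (Function.update x i y) * b (Function.update x i y) - a) ^ 2)
        ≤ 2 * (bmo2 b ^ 2 + ENNReal.ofReal (ε ^ 2)) * volume (dyadicCubeSet c) := by
  have hB : BddMeas b := ⟨hb, 1, hb1⟩
  filter_upwards [ae_all_iff.2 fun c => ae_setLIntegral_sliceDev_le i c hB] with x hx c hc
  set B := ⨍ z in dyadicCubeSet c, b (Function.update x i z)
  refine ⟨φ (Function.update x i c.corner) * B, ?_⟩
  have hB1 : |B| ≤ 1 := abs_setAverage_le (fun y => hb1 _) (volume_dyadicCubeSet_ne_top _)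
    (volume_dyadicCubeSet_ne_zero _)
  calc ∫⁻ y in dyadicCubeSet c, ENNReal.ofReal ((φ (Function.update x i y) *
          b (Function.update x i y) - φ (Function.update x i c.corner) * B) ^ 2)
      ≤ ∫⁻ y in dyadicCubeSet c, 2 * (sliceDev i c b (Function.update x i y)
          + ENNReal.ofReal (ε ^ 2)) := by
        refine setLIntegral_mono' (measurableSet_dyadicCubeSet c) fun y hy => ?_
        have h := sq_mul_sub_mul_le (u := b (Function.update x i y)) (hφ1 (Function.update x i y))
          hB1 ((abs_sub_update_le hφ hφgrad x y c.corner).trans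
            ((DyadicCube.norm_sub_le hy c.corner_mem).trans hc))
        refine (ENNReal.ofReal_le_ofReal h).trans_eq ?_
        rw [ENNReal.ofReal_mul zero_le_two, ENNReal.ofReal_add (sq_nonneg _) (sq_nonneg _)]
        simp [sliceDev, B]
    _ = 2 * ((∫⁻ y in dyadicCubeSet c, sliceDev i c b (Function.update x i y))
          + ENNReal.ofReal (ε ^ 2) * volume (dyadicCubeSet c)) := by
        rw [lintegral_const_mul' _ _ (by simp), lintegral_add_right _ measurable_const,
          setLIntegral_const]
    _ ≤ 2 * (bmo2 b ^ 2 * volume (dyadicCubeSet c)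
          + ENNReal.ofReal (ε ^ 2) * volume (dyadicCubeSet c)) := by
        gcongr
        exact hx c
    _ = _ := by ring

lemma volume_dyadicRectSet (R : DyadicRect n) :
    volume (dyadicRectSet R) = ENNReal.ofReal (∏ i, ((2 : ℝ) ^ (R i).k) ^ n i) := by
  have : dyadicRectSet R = Set.univ.pi fun i => dyadicCubeSet (R i) := by
    ext x
    simp [dyadicRectSet]
  rw [this, volume_pi_pi, ENNReal.ofReal_prod_of_nonneg fun i _ => by positivity]
  refine Finset.prod_congr rfl fun i _ => ?_
  rw [volume_dyadicCubeSet, ENNReal.ofReal_pow (by positivity)]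

/-- A rectangle of small volume has a short side. -/
lemma exists_side_le (hd : 1 ≤ d) (hn : ∀ i, 1 ≤ n i) {α : ℝ} (hα : 0 < α) {R : DyadicRect n}
    (hR : volume (dyadicRectSet R) ≤ ENNReal.ofReal α) :
    ∃ i, (2 : ℝ) ^ (R i).k ≤ α ^ (1 / ((∑ i, n i : ℕ) : ℝ)) := by
  by_contra! h
  have hne : (Finset.univ : Finset (Fin d)).Nonempty := ⟨⟨0, hd⟩, Finset.mem_univ _⟩
  have hN : (∑ i, n i) ≠ 0 := (Finset.sum_pos (fun i _ => hn i) hne).ne'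
  set ε := α ^ (1 / ((∑ i, n i : ℕ) : ℝ))
  have hε : 0 < ε := by positivity
  rw [volume_dyadicRectSet, ENNReal.ofReal_le_ofReal_iff hα.le] at hR
  have h1 : ∏ i, ε ^ n i < ∏ i, ((2 : ℝ) ^ (R i).k) ^ n i :=
    Finset.prod_lt_prod_of_nonempty (fun i _ => by positivity)
      (fun i _ => pow_lt_pow_left₀ (h i) hε.le (by have := hn i; omega)) hne
  rw [Finset.prod_pow_eq_pow_sum] at h1
  have h2 : ε ^ (∑ i, n i) = α := by
    simp only [ε, one_div]
    exact Real.rpow_inv_natCast_pow hα.le hN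
  linarith

/-- The sum over the rectangles contained in `Ω` whose `i`-th side is at most `ε`. -/
lemma tsum_lintegral_sq_deltaList_side_le {φ b : ProductSpace n → ℝ} (hφ : ContDiff ℝ 1 φ)
    (hφ1 : ∀ x, |φ x| ≤ 1) {i : Fin d}
    (hφgrad : ∀ x, ∑ j, |fderiv ℝ φ x (Pi.single i (Pi.single j (1 : ℝ)))| ≤ 1)
    (hb : Measurable b) (hb1 : ∀ x, |b x| ≤ 1) (ε : ℝ) {Ω : Set (ProductSpace n)}
    (hΩ : MeasurableSet Ω) :
    ∑' R, {R | dyadicRectSet R ⊆ Ω ∧ (2 : ℝ) ^ (R i).k ≤ ε}.indicator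
        (fun R => ∫⁻ x, ENNReal.ofReal
          (deltaList (List.finRange d) R (fun x => φ x * b x) x ^ 2)) R
      ≤ 2 * (bmo2 b ^ 2 + ENNReal.ofReal (ε ^ 2)) * volume Ω := by
  set S : Set (DyadicRect n) := {R | dyadicRectSet R ⊆ Ω ∧ (2 : ℝ) ^ (R i).k ≤ ε}
  have hf : BddMeas fun x => φ x * b x :=
    BddMeas.mul ⟨hφ.continuous.measurable, 1, hφ1⟩ ⟨hb, 1, hb1⟩
  set R₀ : DyadicRect n := fun _ => ⟨0, 0⟩
  refine (tsum_lintegral_sq_deltaList_le S i hf R₀).trans ?_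
  refine (tsum_lintegral_sq_deltaBlock_le hf _ (fun c => measurableSet_shadow _ _ _)
    (fun c x y => update_mem_shadow_iff (by simp) x y)
    (w := fun _ => 2 * (bmo2 b ^ 2 + ENNReal.ofReal (ε ^ 2))) measurable_const hΩ
    (fun c x hx y hy => ?_) ?_).trans_eq ?_
  · obtain ⟨R, hR, -, h⟩ := update_mem_shadow_of_mem (s := ∅) (by simp) (by simpa using hx) hy
    exact hR.1 fun j => h j (by simp)
  · filter_upwards [ae_forall_exists_setLIntegral_sq_le hφ hφ1 hφgrad hb hb1 ε] with x hx c hc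
    obtain ⟨R, hR, h, -⟩ := hc
    have hc : (2 : ℝ) ^ c.k ≤ ε := by
      have := hR.2
      rwa [h i (by simp), Function.update_self] at this
    obtain ⟨a, ha⟩ := hx c hc
    exact ⟨a, by rwa [setLIntegral_const]⟩
  · rw [lintegral_indicator hΩ, setLIntegral_const]

end Final

/-- Lemma B: if `φ ∈ C¹` with `‖φ‖_∞ ≤ 1` and
`‖∇_{x_i} φ(x)‖_{ℓ¹} ≤ 1` for each block `i`, and `‖b‖_∞ ≤ 1`, then for every
`0 < α < 1` and open `Ω` of finite measure,
`∑_{R ⊆ Ω, |R| ≤ α} ‖Δ_R(φb)‖₂² ≤ 2·d!·(‖b‖_{bmo,2}² + α^{2/n})·|Ω|`. -/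
theorem statement2 {d : ℕ} (hd : 1 ≤ d) (n : Fin d → ℕ) (hn : ∀ i, 1 ≤ n i)
    (φ b : ProductSpace n → ℝ)
    (hφ : ContDiff ℝ 1 φ) (hφ1 : ∀ x, |φ x| ≤ 1)
    (hφgrad : ∀ x, ∀ i : Fin d, ∑ j, |fderiv ℝ φ x (Pi.single i (Pi.single j (1 : ℝ)))| ≤ 1)
    (hb : Measurable b) (hb1 : ∀ᵐ x ∂(volume : Measure (ProductSpace n)), |b x| ≤ 1)
    (α : ℝ) (hα0 : 0 < α) (hα1 : α < 1)
    (Ω : Set (ProductSpace n)) (hΩ : IsOpen Ω) (hΩfin : volume Ω < ⊤) :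
    ∑' R : {R : DyadicRect n //
        dyadicRectSet R ⊆ Ω ∧ volume (dyadicRectSet R) ≤ ENNReal.ofReal α},
      l2normSq (deltaR R.1 (fun x => φ x * b x))
      ≤ 2 * (Nat.factorial d : ℝ≥0∞) *
          (bmo2 b ^ 2 + ENNReal.ofReal (α ^ ((2 : ℝ) / ((∑ i, n i : ℕ) : ℝ)))) *
          volume Ω := by
  set ε := α ^ (1 / ((∑ i, n i : ℕ) : ℝ))
  have hε : ε ^ 2 = α ^ ((2 : ℝ) / ((∑ i, n i : ℕ) : ℝ)) := by
    rw [← Real.rpow_natCast ε 2, ← Real.rpow_mul hα0.le]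
    congr 1
    push_cast
    ring
  set b' : ProductSpace n → ℝ := fun x => max (-1) (min 1 (b x))
  have hb'm : Measurable b' := measurable_const.max (measurable_const.min hb)
  have hb'1 : ∀ x, |b' x| ≤ 1 := fun x =>
    abs_le.2 ⟨le_max_left _ _, max_le (by norm_num) (min_le_left _ _)⟩
  have hbb' : b =ᵐ[volume] b' := by
    filter_upwards [hb1] with x hx
    rw [abs_le] at hx
    simp [b', hx.1, hx.2]
  have hf : (fun x => φ x * b x) =ᵐ[volume] fun x => φ x * b' x := by
    filter_upwards [hbb'] with x hx
    rw [hx]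
  set F : DyadicRect n → ℝ≥0∞ := fun R =>
    ∫⁻ x, ENNReal.ofReal (deltaList (List.finRange d) R (fun x => φ x * b' x) x ^ 2)
  have hF : ∀ R, l2normSq (deltaR R fun x => φ x * b x) = F R := fun R => by
    refine lintegral_congr_ae ?_
    filter_upwards [deltaList_congr_ae (List.finRange d) R hf] with x hx
    rw [← hx]
    rfl
  simp only [hF]
  rw [bmo2_congr_ae hbb', ← hε]
  set K := bmo2 b' ^ 2 + ENNReal.ofReal (ε ^ 2)
  calc ∑' R : {R : DyadicRect n //
        dyadicRectSet R ⊆ Ω ∧ volume (dyadicRectSet R) ≤ ENNReal.ofReal α}, F R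
      = ∑' R, {R : DyadicRect n | dyadicRectSet R ⊆ Ω ∧
          volume (dyadicRectSet R) ≤ ENNReal.ofReal α}.indicator F R :=
        tsum_subtype {R : DyadicRect n | dyadicRectSet R ⊆ Ω ∧
          volume (dyadicRectSet R) ≤ ENNReal.ofReal α} F
    _ ≤ ∑' R, ∑ i, {R : DyadicRect n | dyadicRectSet R ⊆ Ω ∧
          (2 : ℝ) ^ (R i).k ≤ ε}.indicator F R := by
        refine ENNReal.tsum_le_tsum fun R => Set.indicator_apply_le' (fun hR => ?_) fun _ => zero_le
        obtain ⟨i, hi⟩ := exists_side_le hd hn hα0 hR.2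
        rw [← Set.indicator_of_mem (show R ∈ {R : DyadicRect n | dyadicRectSet R ⊆ Ω ∧
          (2 : ℝ) ^ (R i).k ≤ ε} from ⟨hR.1, hi⟩) F]
        exact Finset.single_le_sum (f := fun i => {R : DyadicRect n | dyadicRectSet R ⊆ Ω ∧
          (2 : ℝ) ^ (R i).k ≤ ε}.indicator F R) (fun _ _ => zero_le) (Finset.mem_univ i)
    _ = ∑ i, ∑' R, {R : DyadicRect n | dyadicRectSet R ⊆ Ω ∧
          (2 : ℝ) ^ (R i).k ≤ ε}.indicator F R :=
        Summable.tsum_finsetSum fun _ _ => ENNReal.summable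
    _ ≤ ∑ _i : Fin d, 2 * K * volume Ω :=
        Finset.sum_le_sum fun i _ => tsum_lintegral_sq_deltaList_side_le hφ hφ1
          (fun x => hφgrad x i) hb'm hb'1 ε hΩ.measurableSet
    _ = d * (2 * K * volume Ω) := by simp
    _ ≤ (Nat.factorial d : ℝ≥0∞) * (2 * K * volume Ω) := by
        gcongr
        exact Nat.self_le_factorial d
    _ = 2 * (Nat.factorial d : ℝ≥0∞) * K * volume Ω := by ring
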